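/- arXiv:2204.01951 — 2 statements merged into one kernel-verified Lean document; each statement's English description precedes it below -/
import Mathlib

section
/- Let f and g be functions on the torus 𝕋ⁿ. Let m ≥ 0, s₁ < 1 + n/2, s₂ < n/2 and m + s₁ + s₂ > 0. Assume f ∈ H^{s₁} ∩ H^{m+s₁} and g ∈ H^{s₂} ∩ H^{m+s₂}. Then there exist a constant C = C(m, n, s₁, s₂) > 0 and a nonnegative sequence {c_q} ∈ ℓ² with ‖c_q‖_{ℓ²} ≤ 1 such that for every q ≥ 0, ‖∆̃_q([f, Δ_q] g)‖_{L²} ≤ C c_q λ_q^{−(m+s₁+s₂−n/2)} (‖f‖_{H^{m+s₁}} ‖g‖_{H^{s₂}} + ‖f‖_{H^{s₁}} ‖g‖_{H^{m+s₂}}). -/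
/-!
The commutator estimate for Littlewood–Paley projections on the torus
`𝕋ⁿ = [-L, L]ⁿ` (Lemma 2.3 of the paper), formulated on the Fourier side.
-/

open Filter Topology MeasureTheory

noncomputable section

/-- The Euclidean norm `|k|` of a frequency `k ∈ ℤⁿ` on the torus `𝕋ⁿ = [-L, L]ⁿ`. -/
def freqNorm {n : ℕ} (k : Fin n → ℤ) : ℝ := Real.sqrt (∑ i, ((k i : ℝ)) ^ 2)

/-- The `L²` norm of a function on `𝕋ⁿ`, via its Fourier coefficients. -/
def l2Norm {n : ℕ} (c : (Fin n → ℤ) → ℂ) : ℝ := (∑' k, ‖c k‖ ^ 2) ^ (1 / 2 : ℝ)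

/-- The `H^s` norm of a function on `𝕋ⁿ`, via its Fourier coefficients. -/
def hsNorm {n : ℕ} (s : ℝ) (c : (Fin n → ℤ) → ℂ) : ℝ :=
  (∑' k, ((1 : ℝ) + freqNorm k ^ 2) ^ s * ‖c k‖ ^ 2) ^ (1 / 2 : ℝ)

/-- Membership in the Sobolev space `H^s(𝕋ⁿ)`, via Fourier coefficients. -/
def memHs {n : ℕ} (s : ℝ) (c : (Fin n → ℤ) → ℂ) : Prop :=
  Summable fun k : Fin n → ℤ => ((1 : ℝ) + freqNorm k ^ 2) ^ s * ‖c k‖ ^ 2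

/-- A standard radial Littlewood–Paley cutoff profile: a smooth nonnegative
function equal to `1` for `|r| ≤ 3/4` and to `0` for `|r| ≥ 1`. -/
def IsLPCutoff (χ : ℝ → ℝ) : Prop :=
  ContDiff ℝ (⊤ : ℕ∞) χ ∧ (∀ r : ℝ, |r| ≤ 3 / 4 → χ r = 1) ∧ (∀ r : ℝ, 1 ≤ |r| → χ r = 0) ∧
    ∀ r : ℝ, 0 ≤ χ r ∧ χ r ≤ 1

/-- The dyadic frequency `λ_q = 2^q / L`. -/
def lpFreq (L : ℝ) (q : ℤ) : ℝ := 2 ^ q / L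

/-- The Fourier symbol of the Littlewood–Paley projection `Δ_q`
(`χ` itself for `q = -1`, and `φ(λ_q⁻¹ ·)` with `φ(r) = χ(r/2) - χ(r)` for `q ≥ 0`). -/
def lpSymbol (χ : ℝ → ℝ) (L : ℝ) (q : ℤ) (r : ℝ) : ℝ :=
  if q = -1 then χ r else χ (r / (2 * lpFreq L q)) - χ (r / lpFreq L q)

/-- The `q`-th Littlewood–Paley projection `Δ_q`, on the Fourier side. -/
def lpProj {n : ℕ} (χ : ℝ → ℝ) (L : ℝ) (q : ℤ) (c : (Fin n → ℤ) → ℂ) : (Fin n → ℤ) → ℂ :=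
  fun k => ((lpSymbol χ L q (freqNorm k) : ℝ) : ℂ) * c k

/-- `∆̃_q u = u_{q-1} + u_q + u_{q+1}`. -/
def lpProjT {n : ℕ} (χ : ℝ → ℝ) (L : ℝ) (q : ℤ) (c : (Fin n → ℤ) → ℂ) : (Fin n → ℤ) → ℂ :=
  fun k => lpProj χ L (q - 1) c k + lpProj χ L q c k + lpProj χ L (q + 1) c k

/-- Fourier coefficients of the product `f g` (convolution of coefficients). -/
def convF {n : ℕ} (c d : (Fin n → ℤ) → ℂ) : (Fin n → ℤ) → ℂ :=
  fun k => ∑' m, c m * d (k - m)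

/-- The commutator `[f, Δ_q] g = f Δ_q g - Δ_q (f g)`, on the Fourier side. -/
def lpComm {n : ℕ} (χ : ℝ → ℝ) (L : ℝ) (q : ℤ) (f g : (Fin n → ℤ) → ℂ) :
    (Fin n → ℤ) → ℂ :=
  fun k => convF f (lpProj χ L q g) k - lpProj χ L q (convF f g) k

/-! ### General summation lemmas -/

open scoped ENNReal

lemma cs_tsum {ι : Type*} (a b : ι → ℝ≥0∞) :
    (∑' i, a i * b i) ^ 2 ≤ (∑' i, a i ^ 2) * ∑' i, b i ^ 2 := by
  let _ : MeasurableSpace ι := ⊤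
  have h := ENNReal.lintegral_mul_le_Lp_mul_Lq (Measure.count : Measure ι)
    (Real.HolderConjugate.two_two) (f := a) (g := b)
    (measurable_from_top).aemeasurable (measurable_from_top).aemeasurable
  simp only [lintegral_count, Pi.mul_apply] at h
  have h2 := pow_le_pow_left' h 2
  refine h2.trans (le_of_eq ?_)
  rw [mul_pow]
  have key : ∀ x : ℝ≥0∞, (x ^ (1 / (2:ℝ))) ^ 2 = x := by
    intro x
    rw [← ENNReal.rpow_natCast, ← ENNReal.rpow_mul]; norm_num
  rw [key, key]
  have e2 : ∀ x : ℝ≥0∞, x ^ (2:ℝ) = x ^ 2 := by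
    intro x; rw [← ENNReal.rpow_natCast]; norm_num
  simp only [e2]

lemma young_tsum {G : Type*} [AddCommGroup G] (a b : G → ℝ≥0∞) :
    ∑' k, (∑' j, a j * b (k - j)) ^ 2 ≤ (∑' j, a j) ^ 2 * ∑' l, b l ^ 2 := by
  have key : ∀ x : ℝ≥0∞, (x ^ (1 / (2:ℝ))) ^ 2 = x := by
    intro x
    rw [← ENNReal.rpow_natCast, ← ENNReal.rpow_mul]; norm_num
  have h1 : ∀ k, (∑' j, a j * b (k - j)) ^ 2 ≤ (∑' j, a j) * ∑' j, a j * b (k - j) ^ 2 := by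
    intro k
    have h := cs_tsum (fun j => a j ^ (1/(2:ℝ))) (fun j => a j ^ (1/(2:ℝ)) * b (k - j))
    simp only [mul_pow, key] at h
    refine le_trans (le_of_eq ?_) h
    congr 1
    refine tsum_congr fun j => ?_
    rw [← mul_assoc, ← sq, key]
  calc _ ≤ ∑' k, (∑' j, a j) * ∑' j, a j * b (k - j) ^ 2 := ENNReal.tsum_le_tsum h1
    _ = (∑' j, a j) * ∑' j, a j * ∑' k, b (k - j) ^ 2 := by
        rw [ENNReal.tsum_mul_left, ENNReal.tsum_comm]
        simp only [ENNReal.tsum_mul_left]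
    _ = (∑' j, a j) * ∑' j, a j * ∑' l, b l ^ 2 := by
        congr 1
        refine tsum_congr fun j => ?_
        congr 1
        exact (Equiv.subRight j).tsum_eq (fun l => b l ^ 2)
    _ = _ := by rw [ENNReal.tsum_mul_right, sq, mul_assoc]

lemma young_tsum' {G : Type*} [AddCommGroup G] (a b : G → ℝ≥0∞) :
    ∑' k, (∑' j, a j * b (k - j)) ^ 2 ≤ (∑' j, b j) ^ 2 * ∑' l, a l ^ 2 := by
  refine le_trans (le_of_eq ?_) (young_tsum b a)
  refine tsum_congr fun k => ?_
  congr 1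
  rw [← (Equiv.subLeft k).tsum_eq]
  refine tsum_congr fun j => ?_
  simp [mul_comm]

lemma cmp_rpow {a b K : ℝ} (ha : 0 < a) (hb : 0 < b) (h1 : a ≤ K * b) (h2 : b ≤ K * a) (p : ℝ) :
    a ^ p ≤ K ^ |p| * b ^ p := by
  have hK : 0 < K := by
    by_contra h
    push Not at h
    nlinarith
  rcases le_total 0 p with hp | hp
  · rw [abs_of_nonneg hp, ← Real.mul_rpow hK.le hb.le]
    exact Real.rpow_le_rpow ha.le h1 hp
  · rw [abs_of_nonpos hp]
    have h3 : (K * a) ^ p ≤ b ^ p := Real.rpow_le_rpow_of_nonpos hb h2 hp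
    rw [Real.mul_rpow hK.le ha.le] at h3
    rw [Real.rpow_neg hK.le]
    have : 0 < K ^ p := Real.rpow_pos_of_pos hK p
    rw [← div_eq_inv_mul, le_div_iff₀ this]
    linarith

lemma geom_dyadic (σ : ℝ) (hσ : 0 < σ) : ∃ C > (0:ℝ), ∀ Q : ℝ, 0 < Q → ∀ N : ℕ,
    ∑ q ∈ Finset.range N, (if (2:ℝ) ^ q ≤ Q then ((2:ℝ) ^ q / Q) ^ σ else 0) ≤ C := by
  set r : ℝ := 2 ^ σ with hr
  have hr1 : 1 < r := Real.one_lt_rpow (by norm_num) hσ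
  refine ⟨r / (r - 1), div_pos (by linarith) (by linarith), ?_⟩
  intro Q hQ N
  have e : ∀ q : ℕ, ((2:ℝ) ^ q / Q) ^ σ = r ^ q / Q ^ σ := by
    intro q
    rw [Real.div_rpow (by positivity) hQ.le, hr, ← Real.rpow_natCast, ← Real.rpow_natCast,
      ← Real.rpow_mul (by norm_num), ← Real.rpow_mul (by norm_num), mul_comm]
  have hQs : 0 < Q ^ σ := Real.rpow_pos_of_pos hQ σ
  have full : ∀ N : ℕ, ∑ q ∈ Finset.range N,
      (if (2:ℝ) ^ q ≤ Q then ((2:ℝ) ^ q / Q) ^ σ else 0) ≤ r ^ N / (r - 1) / Q ^ σ := by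
    intro N
    induction N with
    | zero => simp only [Finset.range_zero, Finset.sum_empty]; exact div_nonneg (div_nonneg (by positivity) (by linarith)) hQs.le
    | succ N ih => 
      rw [Finset.sum_range_succ]
      have : (if (2:ℝ) ^ N ≤ Q then ((2:ℝ) ^ N / Q) ^ σ else 0) ≤ r ^ N / Q ^ σ := by
        split_ifs
        · exact (e N).le
        · positivity
      have h2 : r ^ N / (r - 1) / Q ^ σ + r ^ N / Q ^ σ = r ^ (N + 1) / (r - 1) / Q ^ σ := by
        have : r - 1 ≠ 0 := by linarith
        field_simp
        ring
      linarith
  induction N with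
  | zero => simp; exact (div_pos (by linarith) (by linarith)).le
  | succ N ih =>
    by_cases h : (2:ℝ) ^ N ≤ Q
    · refine (full (N + 1)).trans ?_
      have h3 : r ^ N ≤ Q ^ σ := by
        have := Real.rpow_le_rpow (by positivity) h hσ.le
        rwa [← Real.rpow_natCast, ← Real.rpow_mul (by norm_num), mul_comm,
          Real.rpow_mul (by norm_num), Real.rpow_natCast] at this
      rw [div_div, mul_comm (r-1), ← div_div]
      have h4 : r ^ (N + 1) / Q ^ σ ≤ r := by
        rw [div_le_iff₀ hQs, pow_succ]
        nlinarith
      exact div_le_div_of_nonneg_right h4 (by linarith)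
    · rw [Finset.sum_range_succ, if_neg h, add_zero]
      exact ih

lemma sum_Icc_rpow (β : ℝ) (h1 : -1 < β) (h0 : β ≤ 0) (N : ℕ) :
    ∑ l ∈ Finset.Icc (-(N:ℤ)) N, (max 1 |(l:ℝ)|) ^ β ≤ 1 + 2 / (β + 1) * (N:ℝ) ^ (β + 1) := by
  induction N with
  | zero => simp [Real.zero_rpow (by linarith : β + 1 ≠ 0)]
  | succ N ih =>
    have hI : Finset.Icc (-((N + 1 : ℕ):ℤ)) ((N + 1 : ℕ):ℤ) =
        insert (-((N:ℤ) + 1)) (insert ((N:ℤ) + 1) (Finset.Icc (-(N:ℤ)) N)) := by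
      ext x; simp only [Finset.mem_Icc, Finset.mem_insert]; push_cast; omega
    rw [hI, Finset.sum_insert (by simp only [Finset.mem_Icc, Finset.mem_insert]; omega),
      Finset.sum_insert (by simp only [Finset.mem_Icc]; omega)]
    have hN : (0:ℝ) < (N:ℝ) + 1 := by positivity
    have e1 : max 1 |((-((N:ℤ) + 1) : ℤ):ℝ)| = (N:ℝ) + 1 := by
      push_cast
      rw [abs_neg, abs_of_pos hN]
      simp
    have e2 : max 1 |((((N:ℤ) + 1) : ℤ):ℝ)| = (N:ℝ) + 1 := by
      push_cast
      rw [abs_of_pos hN]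
      simp
    rw [e1, e2]
    have hb := rpow_one_add_le_one_add_mul_self (s := -(1 / ((N:ℝ) + 1)))
      (by rw [neg_le_neg_iff, div_le_one hN]; linarith [(Nat.cast_nonneg N : (0:ℝ) ≤ N)])
      (p := β + 1) (by linarith) (by linarith)
    have e3 : (1 + -(1 / ((N:ℝ) + 1))) = N / ((N:ℝ) + 1) := by field_simp; ring
    rw [e3, Real.div_rpow (by positivity) hN.le] at hb
    have hp : 0 < ((N:ℝ) + 1) ^ (β + 1) := by positivity
    rw [div_le_iff₀ hp] at hb
    have e4 : ((N:ℝ) + 1) ^ (β + 1) = ((N:ℝ) + 1) ^ β * ((N:ℝ) + 1) := by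
      rw [Real.rpow_add_one hN.ne']
    have e5 : (1 + (β + 1) * -(1 / ((N:ℝ) + 1))) * ((N:ℝ) + 1) ^ (β + 1) =
        ((N:ℝ) + 1) ^ (β + 1) - (β + 1) * ((N:ℝ) + 1) ^ β := by
      rw [e4]; field_simp; ring
    rw [e5] at hb
    have hβ : 0 < β + 1 := by linarith
    have h6 : ((N:ℝ) + 1) ^ β ≤ (((N:ℝ) + 1) ^ (β + 1) - (N:ℝ) ^ (β + 1)) / (β + 1) := by
      rw [le_div_iff₀ hβ]; linarith
    push_cast
    have h7 : 2 / (β + 1) * ((N:ℝ) + 1) ^ (β + 1) = 2 / (β + 1) * (N:ℝ) ^ (β + 1) +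
      2 * ((((N:ℝ) + 1) ^ (β + 1) - (N:ℝ) ^ (β + 1)) / (β + 1)) := by ring
    linarith

/-! ### The Japanese bracket -/

def jb {n : ℕ} (k : Fin n → ℤ) : ℝ := Real.sqrt (1 + freqNorm k ^ 2)

lemma freqNorm_eq {n : ℕ} (k : Fin n → ℤ) :
    freqNorm k = ‖(WithLp.toLp 2 (fun i => (k i : ℝ)) : EuclideanSpace ℝ (Fin n))‖ := by
  simp [freqNorm, EuclideanSpace.norm_eq]

lemma freqNorm_nonneg {n : ℕ} (k : Fin n → ℤ) : 0 ≤ freqNorm k := Real.sqrt_nonneg _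

lemma freqNorm_sub_abs {n : ℕ} (k j : Fin n → ℤ) :
    |freqNorm (k - j) - freqNorm k| ≤ freqNorm j := by
  have e : (WithLp.toLp 2 (fun i => ((k - j) i : ℝ)) : EuclideanSpace ℝ (Fin n)) =
      WithLp.toLp 2 (fun i => (k i : ℝ)) - WithLp.toLp 2 (fun i => (j i : ℝ)) := by
    ext i; simp
  rw [freqNorm_eq, freqNorm_eq, freqNorm_eq, e]
  refine (abs_norm_sub_norm_le _ _).trans ?_
  simp

lemma freqNorm_neg {n : ℕ} (k : Fin n → ℤ) : freqNorm (-k) = freqNorm k := by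
  simp [freqNorm]

lemma jb_neg {n : ℕ} (k : Fin n → ℤ) : jb (-k) = jb k := by
  simp [jb, freqNorm_neg]

lemma jb_sq {n : ℕ} (k : Fin n → ℤ) : jb k ^ 2 = 1 + freqNorm k ^ 2 := by
  rw [jb, Real.sq_sqrt (by positivity)]

lemma one_le_jb {n : ℕ} (k : Fin n → ℤ) : 1 ≤ jb k := by
  rw [jb, Real.one_le_sqrt]; nlinarith [sq_nonneg (freqNorm k)]

lemma jb_pos {n : ℕ} (k : Fin n → ℤ) : 0 < jb k := by linarith [one_le_jb k]

lemma freqNorm_le_jb {n : ℕ} (k : Fin n → ℤ) : freqNorm k ≤ jb k :=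
  Real.le_sqrt_of_sq_le (by linarith)

lemma jb_le {n : ℕ} (k : Fin n → ℤ) : jb k ≤ 1 + freqNorm k := by
  have := freqNorm_nonneg k
  rw [jb, Real.sqrt_le_left (by linarith)]
  nlinarith

lemma jb_rpow {n : ℕ} (k : Fin n → ℤ) (s : ℝ) : jb k ^ (2 * s) = (1 + freqNorm k ^ 2) ^ s := by
  rw [Real.rpow_mul (jb_pos k).le, Real.rpow_two, jb_sq]

lemma jb_add {n : ℕ} (k j : Fin n → ℤ) : jb (k + j) ≤ jb k + jb j := by
  have hk := freqNorm_nonneg k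
  have hj := freqNorm_nonneg j
  have h : freqNorm (k + j) ≤ freqNorm k + freqNorm j := by
    have := freqNorm_sub_abs (k + j) j
    rw [add_sub_cancel_right] at this
    linarith [(abs_le.1 this).1]
  have h1 := one_le_jb k
  have h2 := one_le_jb j
  have h3 := freqNorm_le_jb k
  have h4 := freqNorm_le_jb j
  have : jb (k + j) ^ 2 ≤ (jb k + jb j) ^ 2 := by
    have e1 := jb_sq k
    have e2 := jb_sq j
    have e3 := jb_sq (k + j)
    have h5 : freqNorm (k + j) ^ 2 ≤ (freqNorm k + freqNorm j) ^ 2 :=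
      pow_le_pow_left₀ (freqNorm_nonneg _) h 2
    have h6 : freqNorm k * freqNorm j ≤ jb k * jb j := by gcongr
    nlinarith
  exact le_of_sq_le_sq this (by linarith)

lemma abs_coord_le_jb {n : ℕ} (k : Fin n → ℤ) (i : Fin n) : |(k i : ℝ)| ≤ jb k := by
  refine le_trans ?_ (freqNorm_le_jb k)
  rw [freqNorm]
  refine Real.le_sqrt_of_sq_le ?_
  rw [sq_abs]
  exact Finset.single_le_sum (f := fun i => (k i : ℝ) ^ 2) (fun i _ => sq_nonneg _) (Finset.mem_univ i)

lemma ball_sum_nonpos (n : ℕ) (hn : 0 < n) (α : ℝ) (h1 : -(n:ℝ) < α) (h0 : α ≤ 0) :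
    ∃ C > (0:ℝ), ∀ R > (0:ℝ), ∑' k : Fin n → ℤ, ENNReal.ofReal (if jb k ≤ R then jb k ^ α else 0)
      ≤ ENNReal.ofReal (C * R ^ (α + n)) := by
  have hn' : (0:ℝ) < n := by exact_mod_cast hn
  set β := α / n with hβ
  have hβ1 : -1 < β := by rw [hβ, lt_div_iff₀ hn']; linarith
  have hβ0 : β ≤ 0 := div_nonpos_of_nonpos_of_nonneg h0 hn'.le
  have hb : 0 < β + 1 := by linarith
  refine ⟨(1 + 2 / (β + 1)) ^ n, by positivity, ?_⟩
  intro R hR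
  rcases lt_or_ge R 1 with hR1 | hR1
  · have : ∀ k : Fin n → ℤ, ENNReal.ofReal (if jb k ≤ R then jb k ^ α else 0) = 0 := by
      intro k
      rw [if_neg (by linarith [one_le_jb k])]; simp
    simp [this]
  set N := ⌊R⌋₊ with hN
  have hNR : (N:ℝ) ≤ R := Nat.floor_le hR.le
  classical
  rw [tsum_eq_sum (s := Fintype.piFinset (fun _ : Fin n => Finset.Icc (-(N:ℤ)) N))]
  · rw [← ENNReal.ofReal_sum_of_nonneg]
    · refine ENNReal.ofReal_le_ofReal ?_
      calc _ ≤ ∑ x ∈ Fintype.piFinset (fun _ : Fin n => Finset.Icc (-(N:ℤ)) N),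
            ∏ i, (max 1 |(x i : ℝ)|) ^ β := by
            refine Finset.sum_le_sum fun x _ => ?_
            split_ifs
            · have : jb x ^ α = ∏ i : Fin n, jb x ^ β := by
                rw [Finset.prod_const, Finset.card_univ, Fintype.card_fin, ← Real.rpow_natCast,
                  ← Real.rpow_mul (jb_pos x).le, hβ, div_mul_cancel₀ _ hn'.ne']
              rw [this]
              refine Finset.prod_le_prod (fun i _ => (Real.rpow_pos_of_pos (jb_pos x) _).le) fun i _ => ?_
              exact Real.rpow_le_rpow_of_nonpos (by positivity)
                (max_le (one_le_jb x) (abs_coord_le_jb x i)) hβ0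
            · positivity
        _ = (∑ l ∈ Finset.Icc (-(N:ℤ)) N, (max 1 |(l:ℝ)|) ^ β) ^ n := by
            rw [← Finset.prod_univ_sum (fun _ : Fin n => Finset.Icc (-(N:ℤ)) N)
              (fun _ l => (max 1 |(l:ℝ)|) ^ β)]
            simp
        _ ≤ ((1 + 2 / (β + 1)) * R ^ (β + 1)) ^ n := by
            refine pow_le_pow_left₀ (Finset.sum_nonneg fun _ _ => by positivity) ?_ n
            refine (sum_Icc_rpow β hβ1 hβ0 N).trans ?_
            have a1 : (N:ℝ) ^ (β + 1) ≤ R ^ (β + 1) := Real.rpow_le_rpow (by positivity) hNR hb.le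
            have a2 : 1 ≤ R ^ (β + 1) := Real.one_le_rpow hR1 hb.le
            have a3 : 2 / (β + 1) * (N:ℝ) ^ (β + 1) ≤ 2 / (β + 1) * R ^ (β + 1) := by gcongr
            linarith
        _ = _ := by
            rw [mul_pow, ← Real.rpow_natCast (R ^ (β + 1)), ← Real.rpow_mul hR.le]
            congr 2
            rw [hβ]; field_simp
    · intro x _
      split_ifs
      · exact (Real.rpow_pos_of_pos (jb_pos x) _).le
      · exact le_rfl
  · intro k hk
    rw [if_neg]; · simp
    intro h
    apply hk
    rw [Fintype.mem_piFinset]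
    intro i
    have h2 : |(k i : ℝ)| ≤ R := (abs_coord_le_jb k i).trans h
    have h3 : ((|k i|.toNat : ℕ) : ℝ) ≤ R := by
      have : ((|k i|.toNat : ℕ) : ℤ) = |k i| := Int.toNat_of_nonneg (abs_nonneg _)
      have h4 : ((|k i|.toNat : ℕ) : ℝ) = ((|k i| : ℤ) : ℝ) := by exact_mod_cast congrArg (Int.cast (R := ℝ)) this
      rw [h4]; push_cast; exact h2
    have h5 := Nat.le_floor h3
    rw [← hN] at h5
    rw [Finset.mem_Icc, ← abs_le]
    omega

lemma ball_sum (n : ℕ) (hn : 0 < n) (α : ℝ) (h1 : -(n:ℝ) < α) :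
    ∃ C > (0:ℝ), ∀ R > (0:ℝ), ∑' k : Fin n → ℤ, ENNReal.ofReal (if jb k ≤ R then jb k ^ α else 0)
      ≤ ENNReal.ofReal (C * R ^ (α + n)) := by
  rcases le_total α 0 with h0 | h0
  · exact ball_sum_nonpos n hn α h1 h0
  obtain ⟨C, hC, h⟩ := ball_sum_nonpos n hn 0 (by simpa using hn) le_rfl
  refine ⟨C, hC, fun R hR => ?_⟩
  calc _ ≤ ∑' k : Fin n → ℤ, ENNReal.ofReal (R ^ α) * ENNReal.ofReal (if jb k ≤ R then jb k ^ (0:ℝ) else 0) := by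
        refine ENNReal.tsum_le_tsum fun k => ?_
        rw [← ENNReal.ofReal_mul (by positivity)]
        refine ENNReal.ofReal_le_ofReal ?_
        split_ifs with hk
        · simpa using Real.rpow_le_rpow (jb_pos k).le hk h0
        · simp
    _ ≤ ENNReal.ofReal (R ^ α) * ENNReal.ofReal (C * R ^ ((0:ℝ) + n)) := by
        rw [ENNReal.tsum_mul_left]; gcongr; exact h R hR
    _ = _ := by
        rw [← ENNReal.ofReal_mul (by positivity), zero_add, Real.rpow_add hR]
        congr 1; ring

/-! ### Pointwise estimates -/

def Pf (D lam J x : ℝ) : ℝ := if D * J ≤ lam then J * x else 0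
def Vf (D σ lam t J x : ℝ) : ℝ := if lam ≤ D * J then (J / lam) ^ (-σ) * J ^ t * x else 0
def Uf (D lam l y : ℝ) : ℝ := if l ≤ D * lam then y else 0

lemma Pf_nonneg {D lam J x : ℝ} (hJ : 0 ≤ J) (hx : 0 ≤ x) : 0 ≤ Pf D lam J x := by
  unfold Pf; split_ifs <;> positivity

lemma Vf_nonneg {D σ lam t J x : ℝ} (hl : 0 ≤ lam) (hJ : 0 ≤ J) (hx : 0 ≤ x) :
    0 ≤ Vf D σ lam t J x := by
  unfold Vf; split_ifs <;> positivity

lemma Uf_nonneg {D lam l y : ℝ} (hy : 0 ≤ y) : 0 ≤ Uf D lam l y := by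
  unfold Uf; split_ifs <;> positivity

lemma weight_eq {lam l : ℝ} (hlam : 0 < lam) (hl : 0 < l) (t σ : ℝ) :
    lam ^ (-t) * ((l / lam) ^ (-σ) * l ^ t) = (l / lam) ^ (t - σ) := by
  rw [sub_eq_add_neg, Real.rpow_add (by positivity), Real.div_rpow hl.le hlam.le t,
    Real.rpow_neg hlam.le]
  ring

lemma pointwise_est (A D m s₁ s₂ : ℝ) (hA : 0 < A) (hD : 2 ≤ D) : ∃ C > (0:ℝ),
    ∀ lam κ J l x y M : ℝ, 0 < lam → 0 ≤ x → 0 ≤ y → 2 * lam ≤ D * κ → 3 * κ ≤ D * lam →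
      0 < J → 0 < l → κ ≤ J + l → J ≤ κ + l → l ≤ κ + J → M ≤ A → M ≤ A * (J / lam) →
      M * (x * y) ≤ C * (lam ^ (-1 - (m + s₂)) * (Pf D lam J x * Vf D (m + s₁ + s₂) lam (m + s₂) l y)
        + lam ^ (-(m + s₁)) * (Vf D (m + s₁ + s₂) lam (m + s₁) J x * Uf D lam l y)
        + lam ^ (-(m + s₁ + s₂)) * (Vf D (m + s₁ + s₂) lam (m + s₁) J x * (l ^ s₂ * y))) := by
  have hD0 : 0 < D := by linarith
  have c1 : 0 < D ^ |(-s₁)| := by positivity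
  have c2 : 0 < D ^ |(-s₂)| := by positivity
  have c3 : (0:ℝ) < 2 ^ |s₂| := by positivity
  refine ⟨A * (D ^ |(-s₁)| + D ^ |(-s₂)| + 2 ^ |s₂|), by positivity, ?_⟩
  intro lam κ J l x y M hlam hx hy hk1 hk2 hJ hl t1 t2 t3 hM1 hM2
  set T1 := lam ^ (-1 - (m + s₂)) * (Pf D lam J x * Vf D (m + s₁ + s₂) lam (m + s₂) l y) with hT1
  set T2 := lam ^ (-(m + s₁)) * (Vf D (m + s₁ + s₂) lam (m + s₁) J x * Uf D lam l y) with hT2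
  set T3 := lam ^ (-(m + s₁ + s₂)) * (Vf D (m + s₁ + s₂) lam (m + s₁) J x * (l ^ s₂ * y)) with hT3
  have p1 := @Pf_nonneg D lam J x hJ.le hx
  have p2 := @Vf_nonneg D (m + s₁ + s₂) lam (m + s₂) l y hlam.le hl.le hy
  have p3 := @Vf_nonneg D (m + s₁ + s₂) lam (m + s₁) J x hlam.le hJ.le hx
  have p4 := @Uf_nonneg D lam l y hy
  have n1 : 0 ≤ T1 := by positivity
  have n2 : 0 ≤ T2 := by positivity
  have n3 : 0 ≤ T3 := by positivity
  have hxy : 0 ≤ x * y := by positivity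
  have hDD : D * D ≥ 4 := by nlinarith
  by_cases hcA : D * J ≤ lam
  · -- low frequencies of `f`
    have l1 : lam ≤ D * l := by nlinarith
    have l2 : l ≤ D * lam := by
      have : 4 * J ≤ D * lam := by nlinarith
      nlinarith
    have e : T1 = (J / lam) * (x * ((l / lam) ^ (-s₁) * y)) := by
      rw [hT1, Pf, Vf, if_pos hcA, if_pos l1]
      have w := weight_eq hlam hl (m + s₂) (m + s₁ + s₂)
      rw [show m + s₂ - (m + s₁ + s₂) = -s₁ by ring] at w
      rw [← w, show -1 - (m + s₂) = -1 + -(m + s₂) by ring, Real.rpow_add hlam, Real.rpow_neg_one]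
      field_simp
    have h := cmp_rpow (a := 1) (b := l / lam) (K := D) one_pos (by positivity)
      (by rw [← mul_div_assoc, le_div_iff₀ hlam]; linarith) (by rw [div_le_iff₀ hlam]; linarith) (-s₁)
    rw [Real.one_rpow] at h
    have h2 : M * (x * y) ≤ A * D ^ |(-s₁)| * T1 := by
      calc M * (x * y) ≤ A * (J / lam) * (x * y) := by gcongr
        _ = A * (J / lam) * (x * y) * 1 := by ring
        _ ≤ A * (J / lam) * (x * y) * (D ^ |(-s₁)| * (l / lam) ^ (-s₁)) := by gcongr
        _ = _ := by rw [e]; ring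
    refine h2.trans ?_
    calc A * D ^ |(-s₁)| * T1 ≤ A * (D ^ |(-s₁)| + D ^ |(-s₂)| + 2 ^ |s₂|) * T1 := by
          gcongr; linarith
      _ ≤ _ := by gcongr; linarith
  push Not at hcA
  by_cases hcB : l ≤ 2 * κ
  · have j2 : J ≤ D * lam := by linarith
    have l2 : l ≤ D * lam := by linarith
    have e : T2 = (J / lam) ^ (-s₂) * (x * y) := by
      rw [hT2, Vf, Uf, if_pos hcA.le, if_pos l2]
      have w := weight_eq hlam hJ (m + s₁) (m + s₁ + s₂)
      rw [show m + s₁ - (m + s₁ + s₂) = -s₂ by ring] at w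
      rw [← w]; ring
    have h := cmp_rpow (a := 1) (b := J / lam) (K := D) one_pos (by positivity)
      (by rw [← mul_div_assoc, le_div_iff₀ hlam]; linarith) (by rw [div_le_iff₀ hlam]; linarith) (-s₂)
    rw [Real.one_rpow] at h
    have h2 : M * (x * y) ≤ A * D ^ |(-s₂)| * T2 := by
      calc M * (x * y) ≤ A * (x * y) := by gcongr
        _ = A * (x * y) * 1 := by ring
        _ ≤ A * (x * y) * (D ^ |(-s₂)| * (J / lam) ^ (-s₂)) := by gcongr
        _ = _ := by rw [e]; ring
    refine h2.trans ?_
    calc A * D ^ |(-s₂)| * T2 ≤ A * (D ^ |(-s₁)| + D ^ |(-s₂)| + 2 ^ |s₂|) * T2 := by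
          gcongr; linarith
      _ ≤ _ := by gcongr; linarith
  · push Not at hcB
    have e : T3 = J ^ (-s₂) * l ^ s₂ * (x * y) := by
      rw [hT3, Vf, if_pos hcA.le]
      have : lam ^ (-(m + s₁ + s₂)) * ((J / lam) ^ (-(m + s₁ + s₂)) * J ^ (m + s₁)) = J ^ (-s₂) := by
        rw [← mul_assoc, ← Real.mul_rpow hlam.le (by positivity), mul_div_cancel₀ _ hlam.ne',
          ← Real.rpow_add hJ]
        congr 1; ring
      rw [← this]; ring
    have h := cmp_rpow (a := J) (b := l) (K := 2) hJ hl (by linarith) (by linarith) s₂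
    have h1 : 1 ≤ 2 ^ |s₂| * (J ^ (-s₂) * l ^ s₂) := by
      rw [Real.rpow_neg hJ.le]
      have : 0 < J ^ s₂ := by positivity
      rw [← mul_assoc, mul_comm _ (J ^ s₂)⁻¹, mul_assoc, ← div_eq_inv_mul, le_div_iff₀ this]
      linarith
    have h2 : M * (x * y) ≤ A * 2 ^ |s₂| * T3 := by
      calc M * (x * y) ≤ A * (x * y) := by gcongr
        _ = A * (x * y) * 1 := by ring
        _ ≤ A * (x * y) * (2 ^ |s₂| * (J ^ (-s₂) * l ^ s₂)) := by gcongr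
        _ = _ := by rw [e]; ring
    refine h2.trans ?_
    calc A * 2 ^ |s₂| * T3 ≤ A * (D ^ |(-s₁)| + D ^ |(-s₂)| + 2 ^ |s₂|) * T3 := by
          gcongr; linarith
      _ ≤ _ := by gcongr; linarith

/-! ### Symbols -/

lemma lpFreq_pos {L : ℝ} (hL : 0 < L) (q : ℤ) : 0 < lpFreq L q := by
  unfold lpFreq; positivity

lemma lpFreq_succ {L : ℝ} (q : ℤ) : lpFreq L (q + 1) = 2 * lpFreq L q := by
  unfold lpFreq; rw [zpow_add_one₀ (by norm_num)]; ring

lemma one_le_lpFreq {L : ℝ} (hL : 0 < L) (q : ℕ) : 1 ≤ L * lpFreq L q := by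
  unfold lpFreq
  rw [mul_div_cancel₀ _ hL.ne', zpow_natCast]
  exact one_le_pow₀ (by norm_num)

lemma lpSymbol_abs_le {χ : ℝ → ℝ} (hχ : IsLPCutoff χ) (L : ℝ) (q : ℤ) (r : ℝ) :
    |lpSymbol χ L q r| ≤ 1 := by
  obtain ⟨_, _, _, h⟩ := hχ
  unfold lpSymbol
  split_ifs
  · rw [abs_le]; constructor <;> linarith [h r]
  · have h1 := h (r / (2 * lpFreq L q))
    have h2 := h (r / lpFreq L q)
    rw [abs_le]; constructor <;> linarith

lemma lpSymbol_supp {χ : ℝ → ℝ} (hχ : IsLPCutoff χ) {L : ℝ} (hL : 0 < L) {p : ℤ} (hp : p ≠ -1)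
    {r : ℝ} (hr : 0 ≤ r) (h : lpSymbol χ L p r ≠ 0) : 3 / 4 * lpFreq L p ≤ r ∧ r ≤ 2 * lpFreq L p := by
  obtain ⟨_, h1, h0, _⟩ := hχ
  have hl := lpFreq_pos hL p
  unfold lpSymbol at h
  rw [if_neg hp] at h
  constructor
  · by_contra hc
    push Not at hc
    apply h
    rw [h1, h1, sub_self]
    · rw [abs_of_nonneg (by positivity), div_le_iff₀ hl]; linarith
    · rw [abs_of_nonneg (by positivity), div_le_iff₀ (by positivity)]; linarith
  · by_contra hc
    push Not at hc
    apply h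
    rw [h0, h0, sub_self]
    · rw [abs_of_nonneg (by positivity), le_div_iff₀ hl]; linarith
    · rw [abs_of_nonneg (by positivity), le_div_iff₀ (by positivity)]; linarith

lemma supp_jb {χ : ℝ → ℝ} (hχ : IsLPCutoff χ) {L : ℝ} (hL : 0 < L) (q : ℕ) {n : ℕ}
    (k : Fin n → ℤ) (p : ℤ) (hp : p = q - 1 ∨ p = q ∨ p = q + 1)
    (h : lpSymbol χ L p (freqNorm k) ≠ 0) :
    lpFreq L q ≤ (3 + 1 / L) * jb k ∧ jb k ≤ (2 * L + 4) * lpFreq L q := by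
  have hl := lpFreq_pos hL q
  have h1 := one_le_lpFreq hL q
  have hr := freqNorm_nonneg k
  have j1 := one_le_jb k
  have j2 := jb_le k
  have j3 := freqNorm_le_jb k
  have hLi : 0 < 1 / L := by positivity
  by_cases hp1 : p = -1
  · have hq : q = 0 := by omega
    subst hq
    have e : lpFreq L ((0:ℕ):ℤ) = 1 / L := by simp [lpFreq]
    rw [hp1, lpSymbol, if_pos rfl] at h
    have hr1 : freqNorm k ≤ 1 := by
      by_contra hc
      push Not at hc
      exact h (hχ.2.2.1 _ (by rw [abs_of_nonneg hr]; exact hc.le))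
    refine ⟨by rw [e]; nlinarith, ?_⟩
    nlinarith
  · obtain ⟨a, b⟩ := lpSymbol_supp hχ hL hp1 hr h
    have hf : lpFreq L q ≤ 2 * lpFreq L p ∧ lpFreq L p ≤ 2 * lpFreq L q := by
      rcases hp with rfl | rfl | rfl
      · have := lpFreq_succ (L := L) ((q:ℤ) - 1)
        rw [sub_add_cancel] at this
        have := lpFreq_pos hL ((q:ℤ) - 1)
        constructor <;> linarith
      · constructor <;> linarith
      · have := lpFreq_succ (L := L) (q:ℤ)
        constructor <;> linarith
    constructor
    · nlinarith
    · nlinarith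

lemma lpSymbol_lip {χ : ℝ → ℝ} (hχ : IsLPCutoff χ) : ∃ A > (0:ℝ), ∀ L > (0:ℝ), ∀ q : ℕ, ∀ r r' : ℝ,
    |lpSymbol χ L q r - lpSymbol χ L q r'| ≤ A * (|r - r'| / lpFreq L q) := by
  obtain ⟨hs, _, h0, _⟩ := hχ
  have hc : HasCompactSupport χ := by
    refine HasCompactSupport.intro (isCompact_Icc (a := (-1:ℝ)) (b := 1)) fun x hx => h0 x ?_
    by_contra hlt
    push Not at hlt
    exact hx ⟨(abs_lt.1 hlt).1.le, (abs_lt.1 hlt).2.le⟩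
  obtain ⟨K, hK⟩ := ContDiff.lipschitzWith_of_hasCompactSupport hc hs (by simp)
  refine ⟨2 * K + 1, by positivity, fun L hL q r r' => ?_⟩
  have hl := lpFreq_pos hL q
  set lam := lpFreq L q with hlam
  have hq : ((q:ℤ)) ≠ -1 := by omega
  rw [lpSymbol, lpSymbol, if_neg hq, if_neg hq, ← hlam]
  have l1 := hK.dist_le_mul (r / (2 * lam)) (r' / (2 * lam))
  have l2 := hK.dist_le_mul (r / lam) (r' / lam)
  rw [Real.dist_eq, Real.dist_eq, ← sub_div, abs_div, abs_of_pos (by positivity : 0 < 2 * lam)] at l1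
  rw [Real.dist_eq, Real.dist_eq, ← sub_div, abs_div, abs_of_pos hl] at l2
  have l3 : |r - r'| / (2 * lam) ≤ |r - r'| / lam := by
    gcongr; linarith
  have l4 : (K:ℝ) * (|r - r'| / (2 * lam)) ≤ K * (|r - r'| / lam) := by gcongr
  have l5 : 0 ≤ |r - r'| / lam := by positivity
  have l6 := abs_sub (χ (r / (2 * lam)) - χ (r' / (2 * lam))) (χ (r / lam) - χ (r' / lam))
  rw [show χ (r / (2 * lam)) - χ (r / lam) - (χ (r' / (2 * lam)) - χ (r' / lam)) =
    χ (r / (2 * lam)) - χ (r' / (2 * lam)) - (χ (r / lam) - χ (r' / lam)) by ring]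
  linarith

/-! ### Square sums -/

def Xs {n : ℕ} (s : ℝ) (f : (Fin n → ℤ) → ℂ) : ℝ≥0∞ :=
  ∑' k, ENNReal.ofReal (jb k ^ (2 * s) * ‖f k‖ ^ 2)

def VV {n : ℕ} (D σ lam t : ℝ) (f : (Fin n → ℤ) → ℂ) : ℝ≥0∞ :=
  ∑' k, ENNReal.ofReal (Vf D σ lam t (jb k) ‖f k‖) ^ 2

lemma Xs_eq {n : ℕ} (s : ℝ) (f : (Fin n → ℤ) → ℂ) (hf : memHs s f) :
    Xs s f = ENNReal.ofReal (∑' k, ((1 : ℝ) + freqNorm k ^ 2) ^ s * ‖f k‖ ^ 2) := by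
  rw [ENNReal.ofReal_tsum_of_nonneg (fun k => by positivity) hf, Xs]
  simp only [jb_rpow]

lemma sum_ball_le (n : ℕ) (hn : 0 < n) (e s : ℝ) (h : -(n:ℝ) < 2 * (e - s)) :
    ∃ C > (0:ℝ), ∀ R > (0:ℝ), ∀ f : (Fin n → ℤ) → ℂ,
      (∑' k, ENNReal.ofReal (if jb k ≤ R then jb k ^ e * ‖f k‖ else 0)) ^ 2 ≤
        ENNReal.ofReal (C * R ^ (2 * (e - s) + n)) * Xs s f := by
  obtain ⟨C, hC, hb⟩ := ball_sum n hn _ h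
  refine ⟨C, hC, fun R hR f => ?_⟩
  have hcs := cs_tsum (fun k : Fin n → ℤ => ENNReal.ofReal (if jb k ≤ R then jb k ^ (e - s) else 0))
    (fun k => ENNReal.ofReal (jb k ^ s * ‖f k‖))
  have e1 : ∀ k : Fin n → ℤ, ENNReal.ofReal (if jb k ≤ R then jb k ^ e * ‖f k‖ else 0) =
      ENNReal.ofReal (if jb k ≤ R then jb k ^ (e - s) else 0) * ENNReal.ofReal (jb k ^ s * ‖f k‖) := by
    intro k
    have hj := jb_pos k
    rw [← ENNReal.ofReal_mul (by split_ifs <;> positivity)]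
    congr 1
    split_ifs
    · rw [← mul_assoc, ← Real.rpow_add hj, sub_add_cancel]
    · simp
  have e2 : ∀ k : Fin n → ℤ, ENNReal.ofReal (if jb k ≤ R then jb k ^ (e - s) else 0) ^ 2 =
      ENNReal.ofReal (if jb k ≤ R then jb k ^ (2 * (e - s)) else 0) := by
    intro k
    have hj := jb_pos k
    rw [← ENNReal.ofReal_pow (by split_ifs <;> positivity)]
    congr 1
    split_ifs
    · rw [mul_comm, Real.rpow_mul hj.le, Real.rpow_two]
    · simp
  have e3 : ∀ k : Fin n → ℤ, ENNReal.ofReal (jb k ^ s * ‖f k‖) ^ 2 =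
      ENNReal.ofReal (jb k ^ (2 * s) * ‖f k‖ ^ 2) := by
    intro k
    have hj := jb_pos k
    rw [← ENNReal.ofReal_pow (by positivity), mul_pow, mul_comm 2 s, Real.rpow_mul hj.le, Real.rpow_two]
  simp only [e1]
  refine hcs.trans ?_
  simp only [e2, e3]
  exact mul_le_mul_left (hb R hR) _

lemma sum_VV (L : ℝ) (hL : 0 < L) (D : ℝ) (hD : 0 < D) (σ : ℝ) (hσ : 0 < σ) :
    ∃ C > (0:ℝ), ∀ (n : ℕ) (t : ℝ) (f : (Fin n → ℤ) → ℂ),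
      ∑' q : ℕ, VV D σ (lpFreq L q) t f ≤ ENNReal.ofReal C * Xs t f := by
  obtain ⟨C, hC, hg⟩ := geom_dyadic (2 * σ) (by linarith)
  refine ⟨D ^ (2 * σ) * C, by positivity, fun n t f => ?_⟩
  unfold VV Xs
  rw [ENNReal.tsum_comm, ← ENNReal.tsum_mul_left]
  refine ENNReal.tsum_le_tsum fun k => ?_
  have hj := jb_pos k
  refine ENNReal.tsum_le_of_sum_range_le fun N => ?_
  have hQ : 0 < D * L * jb k := by positivity
  have e : ∀ q : ℕ, ENNReal.ofReal (Vf D σ (lpFreq L q) t (jb k) ‖f k‖) ^ 2 =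
      ENNReal.ofReal ((D ^ (2 * σ) * (jb k ^ (2 * t) * ‖f k‖ ^ 2)) *
        (if (2:ℝ) ^ q ≤ D * L * jb k then ((2:ℝ) ^ q / (D * L * jb k)) ^ (2 * σ) else 0)) := by
    intro q
    have hl := lpFreq_pos hL q
    rw [← ENNReal.ofReal_pow (Vf_nonneg hl.le hj.le (norm_nonneg _))]
    congr 1
    have hiff : lpFreq L q ≤ D * jb k ↔ (2:ℝ) ^ q ≤ D * L * jb k := by
      rw [lpFreq, zpow_natCast, div_le_iff₀ hL]
      constructor <;> intro h <;> linarith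
    rw [Vf]
    by_cases h : lpFreq L q ≤ D * jb k
    · rw [if_pos h, if_pos (hiff.1 h)]
      have h2 : (2:ℝ) ^ q / (D * L * jb k) = (jb k / lpFreq L q)⁻¹ / D := by
        rw [lpFreq, zpow_natCast]; field_simp
      rw [h2, Real.div_rpow (by positivity) hD.le, Real.inv_rpow (by positivity),
        ← Real.rpow_neg (by positivity), mul_pow, mul_pow, ← Real.rpow_natCast (_ ^ (-σ)),
        ← Real.rpow_natCast (_ ^ t), ← Real.rpow_mul (by positivity), ← Real.rpow_mul (by positivity)]
      have hDs : D ^ (2 * σ) ≠ 0 := (Real.rpow_pos_of_pos hD _).ne'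
      push_cast
      rw [show -σ * 2 = -(2 * σ) by ring, show t * 2 = 2 * t by ring]
      field_simp
    · rw [if_neg h, if_neg (fun h' => h (hiff.2 h'))]; simp
  simp only [e]
  rw [← ENNReal.ofReal_sum_of_nonneg, ← Finset.mul_sum, ← ENNReal.ofReal_mul (by positivity)]
  · refine ENNReal.ofReal_le_ofReal ?_
    calc _ ≤ (D ^ (2 * σ) * (jb k ^ (2 * t) * ‖f k‖ ^ 2)) * C := by gcongr; exact hg _ hQ N
      _ = _ := by ring
  · intro q _
    have : 0 ≤ (if (2:ℝ) ^ q ≤ D * L * jb k then ((2:ℝ) ^ q / (D * L * jb k)) ^ (2 * σ) else 0) := by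
      split_ifs <;> positivity
    positivity

lemma summable_conv {n : ℕ} {t s : ℝ} (hts : 0 ≤ t + s) {f g : (Fin n → ℤ) → ℂ}
    (hf : memHs t f) (hg : memHs s g) (k : Fin n → ℤ) : Summable fun j => f j * g (k - j) := by
  set K := 2 * jb k with hK
  have hk := one_le_jb k
  have hg' : Summable fun j => (1 + freqNorm (k - j) ^ 2) ^ s * ‖g (k - j)‖ ^ 2 :=
    (Equiv.subLeft k).summable_iff.2 hg
  refine Summable.of_norm_bounded (hf.add (hg'.mul_left (K ^ |(-(2 * t))|))) fun j => ?_
  have hj := one_le_jb j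
  have hl := one_le_jb (k - j)
  have t1 : jb j ≤ jb k + jb (k - j) := by
    have := jb_add k (-(k - j))
    rw [jb_neg] at this
    simpa using this
  have t2 : jb (k - j) ≤ jb k + jb j := by
    have := jb_add k (-j)
    rwa [jb_neg, ← sub_eq_add_neg] at this
  have h := cmp_rpow (a := jb j) (b := jb (k - j)) (K := K) (by linarith) (by linarith)
    (by nlinarith) (by nlinarith) (-(2 * t))
  have h2 : jb (k - j) ^ (-(2 * t)) ≤ jb (k - j) ^ (2 * s) :=
    Real.rpow_le_rpow_of_exponent_le hl (by linarith)
  rw [norm_mul, ← jb_rpow, ← jb_rpow]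
  set x := ‖f j‖
  set y := ‖g (k - j)‖
  have hx : 0 ≤ x := norm_nonneg _
  have hy : 0 ≤ y := norm_nonneg _
  have hK0 : 0 ≤ K ^ |(-(2 * t))| := Real.rpow_nonneg (by linarith) _
  have h3 : jb j ^ (-(2 * t)) * y ^ 2 ≤ K ^ |(-(2 * t))| * (jb (k - j) ^ (2 * s) * y ^ 2) := by
    rw [← mul_assoc]
    gcongr
    exact h.trans (by gcongr)
  have hp : 0 < jb j ^ t := Real.rpow_pos_of_pos (by linarith) _
  have e1 : jb j ^ (2 * t) = (jb j ^ t) ^ 2 := by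
    rw [mul_comm, Real.rpow_mul (by linarith), Real.rpow_two]
  have e2 : jb j ^ (-(2 * t)) = ((jb j ^ t)⁻¹) ^ 2 := by
    rw [Real.rpow_neg (by linarith), e1, inv_pow]
  rw [e2] at h3
  rw [e1]
  have h4 : x * y = (jb j ^ t * x) * ((jb j ^ t)⁻¹ * y) := by field_simp
  have h5 : 0 ≤ (jb j ^ t * x) := by positivity
  have h6 : 0 ≤ ((jb j ^ t)⁻¹ * y) := by positivity
  rw [h4]
  nlinarith [sq_nonneg (jb j ^ t * x - (jb j ^ t)⁻¹ * y)]

lemma comm_eq {n : ℕ} {χ : ℝ → ℝ} {L : ℝ} {q : ℤ} {f g : (Fin n → ℤ) → ℂ} {k : Fin n → ℤ}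
    (hχ : IsLPCutoff χ) (h : Summable fun j => f j * g (k - j)) :
    lpComm χ L q f g k = ∑' j, (((lpSymbol χ L q (freqNorm (k - j)) - lpSymbol χ L q (freqNorm k) : ℝ)) : ℂ)
      * (f j * g (k - j)) := by
  have hs : Summable fun j => ((lpSymbol χ L q (freqNorm (k - j)) : ℝ) : ℂ) * (f j * g (k - j)) := by
    refine Summable.of_norm_bounded h.norm fun j => ?_
    rw [norm_mul, Complex.norm_real, Real.norm_eq_abs]
    exact mul_le_of_le_one_left (norm_nonneg _) (lpSymbol_abs_le hχ _ _ _)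
  unfold lpComm convF lpProj
  rw [← tsum_mul_left]
  have : ∀ j, f j * (((lpSymbol χ L q (freqNorm (k - j)) : ℝ) : ℂ) * g (k - j)) =
      ((lpSymbol χ L q (freqNorm (k - j)) : ℝ) : ℂ) * (f j * g (k - j)) := fun j => by ring
  simp only [this]
  rw [← hs.tsum_sub (h.mul_left _)]
  refine tsum_congr fun j => ?_
  push_cast; ring

lemma sq_add3 (a b c : ℝ≥0∞) : (a + b + c) ^ 2 ≤ 9 * (a ^ 2 + b ^ 2 + c ^ 2) := by
  set M := max (max a b) c with hM
  have ha : a ≤ M := (le_max_left _ _).trans (le_max_left _ _)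
  have hb : b ≤ M := (le_max_right _ _).trans (le_max_left _ _)
  have hc : c ≤ M := le_max_right _ _
  have h2 : M ^ 2 ≤ a ^ 2 + b ^ 2 + c ^ 2 := by
    rcases max_choice (max a b) c with h | h
    · rcases max_choice a b with h' | h'
      · rw [hM, h, h', add_assoc]; exact le_self_add
      · rw [hM, h, h', add_assoc, add_left_comm]; exact le_self_add
    · rw [hM, h]; exact le_add_self
  calc (a + b + c) ^ 2 ≤ (M + M + M) ^ 2 := by gcongr
    _ = 9 * M ^ 2 := by ring
    _ ≤ _ := by gcongr

/-! ### The core estimate -/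

lemma norm_proj_le {n : ℕ} {χ : ℝ → ℝ} (hχ : IsLPCutoff χ) {L : ℝ} (hL : 0 < L) {A₀ : ℝ}
    (hlip : ∀ L > (0:ℝ), ∀ q : ℕ, ∀ r r' : ℝ,
      |lpSymbol χ L q r - lpSymbol χ L q r'| ≤ A₀ * (|r - r'| / lpFreq L q)) (hA₀ : 0 < A₀)
    {D m s₁ s₂ C : ℝ} (hD1 : 2 * (3 + 1 / L) ≤ D) (hD2 : 3 * (2 * L + 4) ≤ D) (hC : 0 < C)
    (hpt : ∀ lam κ J l x y M : ℝ, 0 < lam → 0 ≤ x → 0 ≤ y → 2 * lam ≤ D * κ → 3 * κ ≤ D * lam →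
      0 < J → 0 < l → κ ≤ J + l → J ≤ κ + l → l ≤ κ + J → M ≤ 6 + 3 * A₀ →
        M ≤ (6 + 3 * A₀) * (J / lam) →
      M * (x * y) ≤ C * (lam ^ (-1 - (m + s₂)) * (Pf D lam J x * Vf D (m + s₁ + s₂) lam (m + s₂) l y)
        + lam ^ (-(m + s₁)) * (Vf D (m + s₁ + s₂) lam (m + s₁) J x * Uf D lam l y)
        + lam ^ (-(m + s₁ + s₂)) * (Vf D (m + s₁ + s₂) lam (m + s₁) J x * (l ^ s₂ * y))))
    {f g : (Fin n → ℤ) → ℂ} (q : ℕ) (k : Fin n → ℤ)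
    (h : Summable fun j => f j * g (k - j)) :
    ‖lpProjT χ L q (lpComm χ L q f g) k‖ₑ ≤ ENNReal.ofReal C *
      (ENNReal.ofReal (lpFreq L q ^ (-1 - (m + s₂))) *
        (∑' j, ENNReal.ofReal (Pf D (lpFreq L q) (jb j) ‖f j‖) *
          ENNReal.ofReal (Vf D (m + s₁ + s₂) (lpFreq L q) (m + s₂) (jb (k - j)) ‖g (k - j)‖)) +
      ENNReal.ofReal (lpFreq L q ^ (-(m + s₁))) *
        (∑' j, ENNReal.ofReal (Vf D (m + s₁ + s₂) (lpFreq L q) (m + s₁) (jb j) ‖f j‖) *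
          ENNReal.ofReal (Uf D (lpFreq L q) (jb (k - j)) ‖g (k - j)‖)) +
      ENNReal.ofReal (lpFreq L q ^ (-(m + s₁ + s₂))) *
        (ENNReal.ofReal (if jb k ≤ D * lpFreq L q then jb k ^ (0:ℝ) else 0) *
        ∑' j, ENNReal.ofReal (Vf D (m + s₁ + s₂) (lpFreq L q) (m + s₁) (jb j) ‖f j‖) *
          ENNReal.ofReal (jb (k - j) ^ s₂ * ‖g (k - j)‖))) := by
  set T : ℝ := lpSymbol χ L (q - 1) (freqNorm k) + lpSymbol χ L q (freqNorm k) +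
    lpSymbol χ L (q + 1) (freqNorm k) with hT
  have e : lpProjT χ L q (lpComm χ L q f g) k = (T : ℂ) * lpComm χ L q f g k := by
    simp only [lpProjT, lpProj, hT]; push_cast; ring
  rw [e]
  by_cases hT0 : T = 0
  · rw [hT0]; simp
  have hsupp : lpFreq L q ≤ (3 + 1 / L) * jb k ∧ jb k ≤ (2 * L + 4) * lpFreq L q := by
    by_cases h1 : lpSymbol χ L (q - 1) (freqNorm k) = 0
    · by_cases h2 : lpSymbol χ L q (freqNorm k) = 0
      · by_cases h3 : lpSymbol χ L (q + 1) (freqNorm k) = 0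
        · exact absurd (by rw [hT, h1, h2, h3]; simp) hT0
        · exact supp_jb hχ hL q k _ (Or.inr (Or.inr rfl)) h3
      · exact supp_jb hχ hL q k _ (Or.inr (Or.inl rfl)) h2
    · exact supp_jb hχ hL q k _ (Or.inl rfl) h1
  have hT3 : |T| ≤ 3 := by
    have a1 := abs_le.1 (lpSymbol_abs_le hχ L (q - 1) (freqNorm k))
    have a2 := abs_le.1 (lpSymbol_abs_le hχ L q (freqNorm k))
    have a3 := abs_le.1 (lpSymbol_abs_le hχ L (q + 1) (freqNorm k))
    rw [abs_le]; constructor <;> linarith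
  have hl := lpFreq_pos hL q
  set lam := lpFreq L q with hlam
  have hk := jb_pos k
  have hk1 : 2 * lam ≤ D * jb k := by nlinarith
  have hk2 : 3 * jb k ≤ D * lam := by nlinarith
  have hk3 : jb k ≤ D * lam := by linarith
  rw [if_pos hk3, Real.rpow_zero, ENNReal.ofReal_one, one_mul, comm_eq hχ h, ← tsum_mul_left]
  refine enorm_tsum_le_tsum_enorm.trans ?_
  simp only [← ENNReal.tsum_mul_left]
  rw [← ENNReal.tsum_add, ← ENNReal.tsum_add, ← ENNReal.tsum_mul_left]
  refine ENNReal.tsum_le_tsum fun j => ?_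
  have hj := jb_pos j
  have hkj := jb_pos (k - j)
  have t0 : jb k ≤ jb j + jb (k - j) := by
    have := jb_add j (k - j); simpa using this
  have t1 : jb j ≤ jb k + jb (k - j) := by
    have := jb_add k (-(k - j))
    rw [jb_neg] at this
    simpa using this
  have t2 : jb (k - j) ≤ jb k + jb j := by
    have := jb_add k (-j)
    rwa [jb_neg, ← sub_eq_add_neg] at this
  set δ := lpSymbol χ L q (freqNorm (k - j)) - lpSymbol χ L q (freqNorm k) with hδ
  have d1 : |δ| ≤ 2 := by
    have a1 := abs_le.1 (lpSymbol_abs_le hχ L q (freqNorm (k - j)))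
    have a2 := abs_le.1 (lpSymbol_abs_le hχ L q (freqNorm k))
    rw [abs_le]; constructor <;> linarith
  have d2 : |δ| ≤ A₀ * (jb j / lam) := by
    refine (hlip L hL q _ _).trans ?_
    gcongr
    exact (freqNorm_sub_abs k j).trans (freqNorm_le_jb j)
  have M1 : |T| * |δ| ≤ 6 + 3 * A₀ := by
    have := abs_nonneg δ
    nlinarith
  have M2 : |T| * |δ| ≤ (6 + 3 * A₀) * (jb j / lam) := by
    have : 0 ≤ jb j / lam := by positivity
    have h3 : |T| * |δ| ≤ 3 * (A₀ * (jb j / lam)) := by gcongr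
    linarith
  have key := hpt lam (jb k) (jb j) (jb (k - j)) ‖f j‖ ‖g (k - j)‖ (|T| * |δ|) hl (norm_nonneg _)
    (norm_nonneg _) hk1 hk2 hj hkj t0 t1 t2 M1 M2
  have e2 : ‖(T : ℂ) * ((δ : ℂ) * (f j * g (k - j)))‖ₑ =
      ENNReal.ofReal (|T| * |δ| * (‖f j‖ * ‖g (k - j)‖)) := by
    rw [← ofReal_norm]
    congr 1
    rw [norm_mul, norm_mul, norm_mul, Complex.norm_real, Complex.norm_real, Real.norm_eq_abs,
      Real.norm_eq_abs]; ring
  rw [e2]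
  refine (ENNReal.ofReal_le_ofReal key).trans (le_of_eq ?_)
  have p1 := @Pf_nonneg D lam (jb j) ‖f j‖ hj.le (norm_nonneg _)
  have p2 := @Vf_nonneg D (m + s₁ + s₂) lam (m + s₂) (jb (k - j)) ‖g (k - j)‖ hl.le hkj.le (norm_nonneg _)
  have p3 := @Vf_nonneg D (m + s₁ + s₂) lam (m + s₁) (jb j) ‖f j‖ hl.le hj.le (norm_nonneg _)
  have p4 := @Uf_nonneg D lam (jb (k - j)) ‖g (k - j)‖ (norm_nonneg _)
  rw [ENNReal.ofReal_mul hC.le, ENNReal.ofReal_add (by positivity) (by positivity),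
    ENNReal.ofReal_add (by positivity) (by positivity), ENNReal.ofReal_mul (by positivity),
    ENNReal.ofReal_mul p1, ENNReal.ofReal_mul (by positivity), ENNReal.ofReal_mul p3,
    ENNReal.ofReal_mul (by positivity), ENNReal.ofReal_mul p3]

lemma core_est (n : ℕ) (hn : 0 < n) (L : ℝ) (hL : 0 < L)
    (χ : ℝ → ℝ) (hχ : IsLPCutoff χ) (m s₁ s₂ : ℝ)
    (hs₁ : s₁ < 1 + n / 2) (hs₂ : s₂ < n / 2) (hsum : 0 < m + s₁ + s₂) :
    ∃ D > (0:ℝ), ∃ C > (0 : ℝ), ∀ f g : (Fin n → ℤ) → ℂ,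
      memHs (m + s₁) f → memHs s₂ g → ∀ q : ℕ,
      ∑' k, ‖lpProjT χ L q (lpComm χ L q f g) k‖ₑ ^ 2 ≤
        ENNReal.ofReal (C * (lpFreq L q ^ (-(m + s₁ + s₂ - n / 2))) ^ 2) *
          (Xs s₁ f * VV D (m + s₁ + s₂) (lpFreq L q) (m + s₂) g +
            VV D (m + s₁ + s₂) (lpFreq L q) (m + s₁) f * Xs s₂ g) := by
  have hn' : (0:ℝ) < n := by exact_mod_cast hn
  obtain ⟨A₀, hA₀, hlip⟩ := lpSymbol_lip hχ
  have hLi : 0 < 1 / L := by positivity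
  set D : ℝ := 2 * (3 + 1 / L) + 3 * (2 * L + 4) with hD
  have hD2 : 2 ≤ D := by linarith
  have hD0 : 0 < D := by linarith
  obtain ⟨C₀, hC₀, hpt⟩ := pointwise_est (6 + 3 * A₀) D m s₁ s₂ (by positivity) hD2
  obtain ⟨C₁, hC₁, hP⟩ := sum_ball_le n hn 1 s₁ (by linarith)
  obtain ⟨C₂, hC₂, hU⟩ := sum_ball_le n hn 0 s₂ (by linarith)
  obtain ⟨C₃, hC₃, hS⟩ := ball_sum n hn 0 (by linarith)
  set c1 := C₁ * (1 / D) ^ (2 * (1 - s₁) + n) with hc1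
  set c2 := C₂ * D ^ (2 * (0 - s₂) + n) with hc2
  set c3 := C₃ * D ^ ((0:ℝ) + n) with hc3
  have hc1p : 0 < c1 := by positivity
  have hc2p : 0 < c2 := by positivity
  have hc3p : 0 < c3 := by positivity
  refine ⟨D, hD0, C₀ ^ 2 * 9 * (c1 + c2 + c3), by positivity, ?_⟩
  intro f g hf hg q
  have hl := lpFreq_pos hL q
  have hnorm := fun k => norm_proj_le hχ hL hlip hA₀ (D := D) (by linarith) (by linarith) hC₀ hpt q k
    (summable_conv (by linarith : 0 ≤ (m + s₁) + s₂) hf hg k)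
  set lam := lpFreq L q with hlam
  set σ := m + s₁ + s₂ with hσ
  set Pe : (Fin n → ℤ) → ℝ≥0∞ := fun j => ENNReal.ofReal (Pf D lam (jb j) ‖f j‖) with hPe
  set Ve : (Fin n → ℤ) → ℝ≥0∞ := fun j => ENNReal.ofReal (Vf D σ lam (m + s₁) (jb j) ‖f j‖) with hVe
  set Be : (Fin n → ℤ) → ℝ≥0∞ := fun j => ENNReal.ofReal (Vf D σ lam (m + s₂) (jb j) ‖g j‖) with hBe
  set Ue : (Fin n → ℤ) → ℝ≥0∞ := fun j => ENNReal.ofReal (Uf D lam (jb j) ‖g j‖) with hUe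
  set We : (Fin n → ℤ) → ℝ≥0∞ := fun j => ENNReal.ofReal (jb j ^ s₂ * ‖g j‖) with hWe
  set Se : (Fin n → ℤ) → ℝ≥0∞ :=
    fun k => ENNReal.ofReal (if jb k ≤ D * lam then jb k ^ (0:ℝ) else 0) with hSe
  set a1 := ENNReal.ofReal (lam ^ (-1 - (m + s₂))) with ha1
  set a2 := ENNReal.ofReal (lam ^ (-(m + s₁))) with ha2
  set a3 := ENNReal.ofReal (lam ^ (-σ)) with ha3
  set Y := (lam ^ (-(σ - n / 2))) ^ 2 with hY
  have hY0 : 0 < Y := by positivity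
  set XB := Xs s₁ f * VV D σ lam (m + s₂) g with hXB
  set VX := VV D σ lam (m + s₁) f * Xs s₂ g with hVX
  have hYe : Y = lam ^ (-(2 * σ) + n) := by
    rw [hY, ← Real.rpow_natCast, ← Real.rpow_mul hl.le]; congr 1; push_cast; ring
  have hWsq : ∑' j, We j ^ 2 = Xs s₂ g := by
    refine tsum_congr fun j => ?_
    have hj := jb_pos j
    rw [hWe, ← ENNReal.ofReal_pow (by positivity), mul_pow, mul_comm 2 s₂, Real.rpow_mul hj.le, Real.rpow_two]
  have B1 : a1 ^ 2 * ∑' k, (∑' j, Pe j * Be (k - j)) ^ 2 ≤ ENNReal.ofReal (c1 * Y) * XB := by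
    have h1 : (∑' j, Pe j) ^ 2 ≤ ENNReal.ofReal (C₁ * (lam / D) ^ (2 * (1 - s₁) + n)) * Xs s₁ f := by
      refine le_trans (le_of_eq ?_) (hP (lam / D) (by positivity) f)
      congr 1
      refine tsum_congr fun j => ?_
      simp only [hPe, Pf, Real.rpow_one, le_div_iff₀ hD0, mul_comm D]
    calc a1 ^ 2 * ∑' k, (∑' j, Pe j * Be (k - j)) ^ 2
        ≤ a1 ^ 2 * ((∑' j, Pe j) ^ 2 * ∑' l, Be l ^ 2) := by gcongr; exact young_tsum Pe Be
      _ ≤ a1 ^ 2 * ((ENNReal.ofReal (C₁ * (lam / D) ^ (2 * (1 - s₁) + n)) * Xs s₁ f) * ∑' l, Be l ^ 2) := by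
          gcongr
      _ = (a1 ^ 2 * ENNReal.ofReal (C₁ * (lam / D) ^ (2 * (1 - s₁) + n))) * XB := by
          rw [hXB, VV]; ring
      _ = _ := by
          congr 1
          rw [ha1, ← ENNReal.ofReal_pow (by positivity), ← ENNReal.ofReal_mul (by positivity)]
          congr 1
          rw [hc1, hYe, div_eq_mul_one_div lam D, Real.mul_rpow hl.le (by positivity),
            ← Real.rpow_natCast, ← Real.rpow_mul hl.le]
          have : lam ^ (-(2 * σ) + n) = lam ^ ((-1 - (m + s₂)) * (2:ℕ)) * lam ^ (2 * (1 - s₁) + n) := by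
            rw [← Real.rpow_add hl]; congr 1; rw [hσ]; push_cast; ring
          rw [this]; ring
  have B2 : a2 ^ 2 * ∑' k, (∑' j, Ve j * Ue (k - j)) ^ 2 ≤ ENNReal.ofReal (c2 * Y) * VX := by
    have h1 : (∑' j, Ue j) ^ 2 ≤ ENNReal.ofReal (C₂ * (D * lam) ^ (2 * (0 - s₂) + n)) * Xs s₂ g := by
      refine le_trans (le_of_eq ?_) (hU (D * lam) (by positivity) g)
      congr 1
      refine tsum_congr fun j => ?_
      simp only [hUe, Uf, Real.rpow_zero, one_mul]
    calc a2 ^ 2 * ∑' k, (∑' j, Ve j * Ue (k - j)) ^ 2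
        ≤ a2 ^ 2 * ((∑' j, Ue j) ^ 2 * ∑' l, Ve l ^ 2) := by gcongr; exact young_tsum' Ve Ue
      _ ≤ a2 ^ 2 * ((ENNReal.ofReal (C₂ * (D * lam) ^ (2 * (0 - s₂) + n)) * Xs s₂ g) * ∑' l, Ve l ^ 2) := by
          gcongr
      _ = (a2 ^ 2 * ENNReal.ofReal (C₂ * (D * lam) ^ (2 * (0 - s₂) + n))) * VX := by
          rw [hVX, VV]; ring
      _ = _ := by
          congr 1
          rw [ha2, ← ENNReal.ofReal_pow (by positivity), ← ENNReal.ofReal_mul (by positivity)]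
          congr 1
          rw [hc2, hYe, Real.mul_rpow hD0.le hl.le,
            ← Real.rpow_natCast, ← Real.rpow_mul hl.le]
          have : lam ^ (-(2 * σ) + n) = lam ^ (-(m + s₁) * (2:ℕ)) * lam ^ (2 * (0 - s₂) + n) := by
            rw [← Real.rpow_add hl]; congr 1; rw [hσ]; push_cast; ring
          rw [this]; ring
  have B3 : a3 ^ 2 * ∑' k, (Se k * ∑' j, Ve j * We (k - j)) ^ 2 ≤ ENNReal.ofReal (c3 * Y) * VX := by
    have h1 : ∀ k, (Se k * ∑' j, Ve j * We (k - j)) ^ 2 ≤ Se k * VX := by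
      intro k
      rw [mul_pow]
      have hs : Se k ^ 2 = Se k := by
        rw [hSe]; dsimp only; split_ifs <;> simp
      rw [hs]
      gcongr
      refine (cs_tsum _ _).trans (le_of_eq ?_)
      rw [hVX, VV, ← hWsq]
      congr 1
      exact (Equiv.subLeft k).tsum_eq (fun l => We l ^ 2)
    calc a3 ^ 2 * ∑' k, (Se k * ∑' j, Ve j * We (k - j)) ^ 2
        ≤ a3 ^ 2 * ∑' k, Se k * VX := by gcongr with k; exact h1 k
      _ = a3 ^ 2 * (∑' k, Se k) * VX := by rw [ENNReal.tsum_mul_right, mul_assoc]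
      _ ≤ a3 ^ 2 * ENNReal.ofReal (C₃ * (D * lam) ^ ((0:ℝ) + n)) * VX := by
          gcongr; exact hS (D * lam) (by positivity)
      _ = _ := by
          congr 1
          rw [ha3, ← ENNReal.ofReal_pow (by positivity), ← ENNReal.ofReal_mul (by positivity)]
          congr 1
          rw [hc3, hYe, Real.mul_rpow hD0.le hl.le,
            ← Real.rpow_natCast, ← Real.rpow_mul hl.le]
          have : lam ^ (-(2 * σ) + n) = lam ^ (-σ * (2:ℕ)) * lam ^ ((0:ℝ) + n) := by
            rw [← Real.rpow_add hl]; congr 1; push_cast; ring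
          rw [this]; ring
  calc ∑' k, ‖lpProjT χ L q (lpComm χ L q f g) k‖ₑ ^ 2
      ≤ ∑' k, ENNReal.ofReal C₀ ^ 2 * (9 * (a1 ^ 2 * (∑' j, Pe j * Be (k - j)) ^ 2 +
          a2 ^ 2 * (∑' j, Ve j * Ue (k - j)) ^ 2 +
          a3 ^ 2 * (Se k * ∑' j, Ve j * We (k - j)) ^ 2)) := by
        refine ENNReal.tsum_le_tsum fun k => ?_
        refine (pow_le_pow_left' (hnorm k) 2).trans ?_
        rw [mul_pow]
        gcongr
        refine (sq_add3 _ _ _).trans (le_of_eq ?_)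
        simp only [mul_pow, hPe, hBe, hVe, hUe, hWe, hSe]
    _ = ENNReal.ofReal C₀ ^ 2 * (9 * (a1 ^ 2 * ∑' k, (∑' j, Pe j * Be (k - j)) ^ 2 +
          a2 ^ 2 * ∑' k, (∑' j, Ve j * Ue (k - j)) ^ 2 +
          a3 ^ 2 * ∑' k, (Se k * ∑' j, Ve j * We (k - j)) ^ 2)) := by
        simp only [ENNReal.tsum_mul_left, ENNReal.tsum_add]
    _ ≤ ENNReal.ofReal C₀ ^ 2 * (9 * (ENNReal.ofReal ((c1 + c2 + c3) * Y) * (XB + VX))) := by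
        gcongr
        calc _ ≤ ENNReal.ofReal (c1 * Y) * XB + ENNReal.ofReal (c2 * Y) * VX +
              ENNReal.ofReal (c3 * Y) * VX := by gcongr
          _ = ENNReal.ofReal (c1 * Y) * XB + ENNReal.ofReal ((c2 + c3) * Y) * VX := by
              rw [add_mul c2, ENNReal.ofReal_add (by positivity) (by positivity)]; ring
          _ ≤ ENNReal.ofReal ((c1 + c2 + c3) * Y) * XB + ENNReal.ofReal ((c1 + c2 + c3) * Y) * VX := by
              gcongr ENNReal.ofReal (?_ * Y) * XB + ENNReal.ofReal (?_ * Y) * VX <;> linarith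
          _ = _ := by ring
    _ = _ := by
        rw [show C₀ ^ 2 * 9 * (c1 + c2 + c3) * Y = C₀ ^ 2 * (9 * ((c1 + c2 + c3) * Y)) by ring,
          ENNReal.ofReal_mul (p := C₀ ^ 2) (by positivity),
          ENNReal.ofReal_mul (p := 9) (by norm_num),
          ENNReal.ofReal_pow hC₀.le, show ENNReal.ofReal 9 = 9 by norm_num]
        ring

/-- **Lemma 2.3.** Let `m ≥ 0`, `s₁ < 1 + n/2`, `s₂ < n/2` and `m + s₁ + s₂ > 0`.
For `f ∈ H^{s₁} ∩ H^{m+s₁}` and `g ∈ H^{s₂} ∩ H^{m+s₂}` there are a constant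
`C = C(m, n, s₁, s₂) > 0` and a sequence `{c_q} ∈ ℓ²` with `‖c_q‖_{ℓ²} ≤ 1` such
that for all `q ≥ 0`,
`‖∆̃_q([f, Δ_q] g)‖_{L²} ≤ C c_q λ_q^{-(m+s₁+s₂-n/2)} (‖f‖_{H^{m+s₁}} ‖g‖_{H^{s₂}} + ‖f‖_{H^{s₁}} ‖g‖_{H^{m+s₂}})`. -/
theorem commutator_estimate (n : ℕ) (hn : 0 < n) (L : ℝ) (hL : 0 < L)
    (χ : ℝ → ℝ) (hχ : IsLPCutoff χ) (m s₁ s₂ : ℝ) (hm : 0 ≤ m)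
    (hs₁ : s₁ < 1 + n / 2) (hs₂ : s₂ < n / 2) (hsum : 0 < m + s₁ + s₂) :
    ∃ C > (0 : ℝ), ∀ f g : (Fin n → ℤ) → ℂ,
      memHs s₁ f → memHs (m + s₁) f → memHs s₂ g → memHs (m + s₂) g →
      ∃ c : ℕ → ℝ, (∀ q, 0 ≤ c q) ∧ (Summable fun q => c q ^ 2) ∧
        (∑' q, c q ^ 2) ≤ 1 ∧
        ∀ q : ℕ,
          l2Norm (lpProjT χ L (q : ℤ) (lpComm χ L (q : ℤ) f g)) ≤
            C * c q * lpFreq L (q : ℤ) ^ (-(m + s₁ + s₂ - n / 2)) *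
              (hsNorm (m + s₁) f * hsNorm s₂ g + hsNorm s₁ f * hsNorm (m + s₂) g) := by
  obtain ⟨D, hD, C₁, hC₁, hcore⟩ := core_est n hn L hL χ hχ m s₁ s₂ hs₁ hs₂ hsum
  obtain ⟨C₂, hC₂, hVV⟩ := sum_VV L hL D hD (m + s₁ + s₂) hsum
  refine ⟨Real.sqrt (C₁ * C₂), by positivity, ?_⟩
  intro f g hf1 hf2 hg1 hg2
  have x1 := Xs_eq _ _ hf1
  have x2 := Xs_eq _ _ hf2
  have y1 := Xs_eq _ _ hg1
  have y2 := Xs_eq _ _ hg2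
  unfold hsNorm
  simp only [← Real.sqrt_eq_rpow]
  set F1 := ∑' k, ((1 : ℝ) + freqNorm k ^ 2) ^ s₁ * ‖f k‖ ^ 2 with hF1
  set F2 := ∑' k, ((1 : ℝ) + freqNorm k ^ 2) ^ (m + s₁) * ‖f k‖ ^ 2 with hF2
  set G1 := ∑' k, ((1 : ℝ) + freqNorm k ^ 2) ^ s₂ * ‖g k‖ ^ 2 with hG1
  set G2 := ∑' k, ((1 : ℝ) + freqNorm k ^ 2) ^ (m + s₂) * ‖g k‖ ^ 2 with hG2
  have hF1n : 0 ≤ F1 := tsum_nonneg fun k => by positivity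
  have hF2n : 0 ≤ F2 := tsum_nonneg fun k => by positivity
  have hG1n : 0 ≤ G1 := tsum_nonneg fun k => by positivity
  have hG2n : 0 ≤ G2 := tsum_nonneg fun k => by positivity
  set Z := F2 * G1 + F1 * G2 with hZ
  have hZn : 0 ≤ Z := by positivity
  set d : ℕ → ℝ≥0∞ := fun q => Xs s₁ f * VV D (m + s₁ + s₂) (lpFreq L q) (m + s₂) g +
    VV D (m + s₁ + s₂) (lpFreq L q) (m + s₁) f * Xs s₂ g with hd
  have hdsum : ∑' q, d q ≤ ENNReal.ofReal (C₂ * Z) := by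
    calc ∑' q, d q = Xs s₁ f * ∑' q : ℕ, VV D (m + s₁ + s₂) (lpFreq L q) (m + s₂) g +
          (∑' q : ℕ, VV D (m + s₁ + s₂) (lpFreq L q) (m + s₁) f) * Xs s₂ g := by
          rw [hd, ENNReal.tsum_add, ENNReal.tsum_mul_left, ENNReal.tsum_mul_right]
      _ ≤ Xs s₁ f * (ENNReal.ofReal C₂ * Xs (m + s₂) g) +
          (ENNReal.ofReal C₂ * Xs (m + s₁) f) * Xs s₂ g := by
          gcongr
          · exact hVV n (m + s₂) g
          · exact hVV n (m + s₁) f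
      _ = _ := by
          rw [x1, x2, y1, y2, hZ, ENNReal.ofReal_mul hC₂.le,
            ENNReal.ofReal_add (by positivity) (by positivity), ENNReal.ofReal_mul hF2n,
            ENNReal.ofReal_mul hF1n]
          ring
  have hdfin : ∑' q, d q ≠ ⊤ := ne_top_of_le_ne_top ENNReal.ofReal_ne_top hdsum
  have hdq : ∀ q, d q ≠ ⊤ := fun q => ENNReal.ne_top_of_tsum_ne_top hdfin q
  have hdS : Summable fun q => (d q).toReal := ENNReal.summable_toReal hdfin
  have hdle : ∑' q, (d q).toReal ≤ C₂ * Z := by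
    rw [← ENNReal.tsum_toReal_eq hdq]
    exact ENNReal.toReal_le_of_le_ofReal (by positivity) hdsum
  have hcsq : ∀ q, Real.sqrt ((d q).toReal / (C₂ * Z)) ^ 2 = (d q).toReal / (C₂ * Z) := fun q =>
    Real.sq_sqrt (by positivity)
  refine ⟨fun q => Real.sqrt ((d q).toReal / (C₂ * Z)), fun q => Real.sqrt_nonneg _, ?_, ?_, ?_⟩
  · simp only [hcsq]; exact hdS.div_const _
  · simp only [hcsq]
    rw [tsum_div_const]
    exact div_le_one_of_le₀ hdle (by positivity)
  · intro q
    have hq := hcore f g hf2 hg1 q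
    set lam := lpFreq L q with hlam
    have hl : 0 < lam := lpFreq_pos hL q
    set Y := lam ^ (-(m + s₁ + s₂ - n / 2)) with hY
    have hY0 : 0 < Y := by positivity
    change _ ≤ ENNReal.ofReal (C₁ * Y ^ 2) * d q at hq
    have hdr : (d q).toReal = C₂ * Z * ((d q).toReal / (C₂ * Z)) := by
      by_cases hZ0 : C₂ * Z = 0
      · have h1 : (d q).toReal ≤ C₂ * Z := (hdS.le_tsum q (fun _ _ => ENNReal.toReal_nonneg)).trans hdle
        have h2 : 0 ≤ (d q).toReal := ENNReal.toReal_nonneg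
        rw [hZ0]; rw [hZ0] at h1; simp; linarith
      · exact (mul_div_cancel₀ _ hZ0).symm
    have hl2 : ∑' k, ‖lpProjT χ L q (lpComm χ L q f g) k‖ ^ 2 ≤ C₁ * Y ^ 2 * (d q).toReal := by
      have h1 : ∑' k, ‖lpProjT χ L q (lpComm χ L q f g) k‖ ^ 2 =
          (∑' k, ‖lpProjT χ L q (lpComm χ L q f g) k‖ₑ ^ 2).toReal := by
        rw [ENNReal.tsum_toReal_eq (fun k => ENNReal.pow_ne_top enorm_ne_top)]
        simp
      rw [h1]
      refine (ENNReal.toReal_mono (ENNReal.mul_ne_top ENNReal.ofReal_ne_top (hdq q)) hq).trans ?_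
      rw [ENNReal.toReal_mul, ENNReal.toReal_ofReal (by positivity)]
    unfold l2Norm
    rw [← Real.sqrt_eq_rpow]
    refine (Real.sqrt_le_sqrt hl2).trans ?_
    rw [hdr, show C₁ * Y ^ 2 * (C₂ * Z * ((d q).toReal / (C₂ * Z))) =
      (C₁ * C₂) * (Y ^ 2 * (((d q).toReal / (C₂ * Z)) * Z)) by ring,
      Real.sqrt_mul (x := C₁ * C₂) (by positivity), Real.sqrt_mul (x := Y ^ 2) (by positivity),
      Real.sqrt_sq hY0.le, Real.sqrt_mul (x := (d q).toReal / (C₂ * Z)) (by positivity)]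
    have hZs : Real.sqrt Z ≤ Real.sqrt F2 * Real.sqrt G1 + Real.sqrt F1 * Real.sqrt G2 := by
      rw [hZ, ← Real.sqrt_mul hF2n, ← Real.sqrt_mul hF1n]
      have a1 : 0 ≤ F2 * G1 := by positivity
      have a2 : 0 ≤ F1 * G2 := by positivity
      rw [Real.sqrt_le_left (by positivity)]
      have b1 := Real.sq_sqrt a1
      have b2 := Real.sq_sqrt a2
      have b3 : 0 ≤ Real.sqrt (F2 * G1) * Real.sqrt (F1 * G2) := by positivity
      linarith [add_sq (Real.sqrt (F2 * G1)) (Real.sqrt (F1 * G2))]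
    calc _ = Real.sqrt (C₁ * C₂) * Real.sqrt ((d q).toReal / (C₂ * Z)) * Y * Real.sqrt Z := by ring
      _ ≤ _ := by gcongr
end
end

section
/- Let s₁, s₂ < 1/2 with s₁ + s₂ > 0, and let f ∈ H^{s₁}(𝕋ⁿ) and g ∈ H^{s₂}(𝕋ⁿ). Then the product fg satisfies ‖fg‖_{H^{s₁+s₂−n/2}} ≤ C ‖f‖_{H^{s₁}} ‖g‖_{H^{s₂}} for a constant C = C(n, s₁, s₂) > 0. -/
/-!
The product estimate `‖fg‖_{H^{s₁+s₂-n/2}} ≤ C ‖f‖_{H^{s₁}} ‖g‖_{H^{s₂}}` on the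
torus `𝕋ⁿ = [-L, L]ⁿ` (Lemma 2.5 of the paper), formulated on the Fourier side.
-/

open Filter Topology MeasureTheory

noncomputable section

lemma pe_step {γ : ℝ} (h0 : 0 < γ) (h1 : γ ≤ 1) (N : ℕ) :
    γ * ((N : ℝ) + 1) ^ (γ - 1) ≤ ((N : ℝ) + 1) ^ γ - (N : ℝ) ^ γ := by
  have hN : (0 : ℝ) < (N : ℝ) + 1 := by positivity
  have hb := rpow_one_add_le_one_add_mul_self (s := -(1 / ((N : ℝ) + 1))) (p := γ)
    (by rw [neg_le_neg_iff, div_le_one hN]; linarith [Nat.cast_nonneg (α := ℝ) N]) h0.le h1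
  have e : (1 + -(1 / ((N : ℝ) + 1))) = (N : ℝ) / (N + 1) := by field_simp; ring
  rw [e, Real.div_rpow (Nat.cast_nonneg N) hN.le, div_le_iff₀ (Real.rpow_pos_of_pos hN γ)] at hb
  rw [Real.rpow_sub_one hN.ne']
  have : γ * (((N : ℝ) + 1) ^ γ / (N + 1)) = γ * (1 / ((N : ℝ) + 1)) * ((N : ℝ) + 1) ^ γ := by ring
  rw [this]; nlinarith

lemma pe_oneD {β : ℝ} (h0 : 0 ≤ β) (h1 : β < 1 / 2) (N : ℕ) :
    ∑ j ∈ Finset.Icc (-(N : ℤ)) N, ((1 : ℝ) + (j : ℝ) ^ 2) ^ (-β)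
      ≤ 1 + 2 / (1 - 2 * β) * (N : ℝ) ^ (1 - 2 * β) := by
  have hγ : 0 < 1 - 2 * β := by linarith
  induction N with
  | zero => simp [Real.zero_rpow hγ.ne']
  | succ N ih =>
    have e : Finset.Icc (-((N + 1 : ℕ) : ℤ)) ((N + 1 : ℕ) : ℤ)
        = insert (-((N : ℤ) + 1)) (insert ((N : ℤ) + 1) (Finset.Icc (-(N : ℤ)) N)) := by
      ext j; simp only [Finset.mem_Icc, Finset.mem_insert]; push_cast; omega
    rw [e, Finset.sum_insert, Finset.sum_insert]
    · have hs := pe_step hγ (by linarith) N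
      have hN : (0 : ℝ) < (N : ℝ) + 1 := by positivity
      have hg : ((1 : ℝ) + ((N : ℝ) + 1) ^ 2) ^ (-β) ≤ ((N : ℝ) + 1) ^ (1 - 2 * β - 1) := by
        have : ((N : ℝ) + 1) ^ (1 - 2 * β - 1) = (((N : ℝ) + 1) ^ 2) ^ (-β) := by
          rw [← Real.rpow_natCast, ← Real.rpow_mul hN.le]; congr 1; push_cast; ring
        rw [this]
        exact Real.rpow_le_rpow_of_nonpos (by positivity) (by linarith) (by linarith)
      push_cast
      rw [neg_sq]
      have h2 : (2 : ℝ) * ((N : ℝ) + 1) ^ (1 - 2 * β - 1)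
          ≤ 2 / (1 - 2 * β) * (((N : ℝ) + 1) ^ (1 - 2 * β) - (N : ℝ) ^ (1 - 2 * β)) := by
        rw [div_mul_eq_mul_div, le_div_iff₀ hγ]; nlinarith
      nlinarith
    · simp
    · simp only [Finset.mem_insert, Finset.mem_Icc]; omega

/-- The weight `1 + |k|²`. -/
def peW {n : ℕ} (k : Fin n → ℤ) : ℝ := 1 + freqNorm k ^ 2

lemma peW_eq {n : ℕ} (k : Fin n → ℤ) : peW k = 1 + ∑ i, ((k i : ℝ)) ^ 2 := by
  unfold peW freqNorm
  rw [Real.sq_sqrt (Finset.sum_nonneg fun i _ => sq_nonneg _)]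

lemma peW_ge {n : ℕ} (k : Fin n → ℤ) : 1 ≤ peW k := by
  unfold peW; nlinarith [sq_nonneg (freqNorm k)]

lemma peW_pos {n : ℕ} (k : Fin n → ℤ) : 0 < peW k := by linarith [peW_ge k]

lemma peW_neg {n : ℕ} (k : Fin n → ℤ) : peW (-k) = peW k := by
  simp [peW_eq]

lemma peW_add {n : ℕ} (k m : Fin n → ℤ) : peW (k + m) ≤ 2 * (peW k + peW m) := by
  simp only [peW_eq, Pi.add_apply, Int.cast_add]
  have : ∑ i, ((k i : ℝ) + m i) ^ 2 ≤ ∑ i, (2 * (k i : ℝ) ^ 2 + 2 * (m i : ℝ) ^ 2) :=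
    Finset.sum_le_sum fun i _ => by nlinarith [sq_nonneg ((k i : ℝ) - m i)]
  rw [Finset.sum_add_distrib, ← Finset.mul_sum, ← Finset.mul_sum] at this
  linarith

lemma peW_coord {n : ℕ} (k : Fin n → ℤ) (i : Fin n) : 1 + (k i : ℝ) ^ 2 ≤ peW k := by
  rw [peW_eq]
  have := Finset.single_le_sum (f := fun i => (k i : ℝ) ^ 2) (fun i _ => sq_nonneg _)
    (Finset.mem_univ i)
  linarith

lemma pe_prod_bound {n : ℕ} (hn : 0 < n) {α : ℝ} (h0 : 0 ≤ α) (k : Fin n → ℤ) :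
    peW k ^ (-α) ≤ ∏ i, ((1 : ℝ) + (k i : ℝ) ^ 2) ^ (-(α / n)) := by
  have hn' : (n : ℝ) ≠ 0 := by positivity
  have : peW k ^ (-α) = ∏ i : Fin n, peW k ^ (-(α / n)) := by
    rw [Finset.prod_const, Finset.card_univ, Fintype.card_fin, ← Real.rpow_natCast,
      ← Real.rpow_mul (peW_pos k).le]
    congr 1; field_simp
  rw [this]
  apply Finset.prod_le_prod
  · intro i _; exact Real.rpow_nonneg (peW_pos k).le _
  · intro i _
    exact Real.rpow_le_rpow_of_nonpos (by positivity) (peW_coord k i)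
      (by rw [neg_nonpos]; positivity)

lemma pe_mem_box {n : ℕ} (k : Fin n → ℤ) {R : ℝ} (h : peW k ≤ R) :
    k ∈ Fintype.piFinset fun _ : Fin n => Finset.Icc (-(⌊√R⌋₊ : ℤ)) ⌊√R⌋₊ := by
  rw [Fintype.mem_piFinset]
  intro i
  rw [Finset.mem_Icc, ← abs_le]
  have h1 := peW_coord k i
  have h2 : |(k i : ℝ)| ≤ √R := by
    apply Real.abs_le_sqrt; linarith
  have h3 : (((k i).natAbs : ℕ) : ℝ) ≤ √R := by
    rw [Nat.cast_natAbs]; push_cast; exact h2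
  have h4 := Nat.le_floor h3
  rw [Int.abs_eq_natAbs]
  exact_mod_cast h4

lemma pe_count0 {n : ℕ} (hn : 0 < n) {α : ℝ} (h0 : 0 ≤ α) (h1 : α < n / 2) :
    ∃ C : ℝ, 0 < C ∧ ∀ R : ℝ, 1 ≤ R →
      ∑ k ∈ Fintype.piFinset (fun _ : Fin n => Finset.Icc (-(⌊√R⌋₊ : ℤ)) ⌊√R⌋₊),
        peW k ^ (-α) ≤ C * R ^ (n / 2 - α) := by
  have hn' : (0 : ℝ) < n := by positivity
  set β := α / n with hβ
  have hb0 : 0 ≤ β := by positivity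
  have hb1 : β < 1 / 2 := by rw [hβ, div_lt_iff₀ hn']; linarith
  have hγ : 0 < 1 - 2 * β := by linarith
  refine ⟨(1 + 2 / (1 - 2 * β)) ^ n, by positivity, fun R hR => ?_⟩
  have hR0 : 0 ≤ R := by linarith
  calc _ ≤ ∑ k ∈ Fintype.piFinset (fun _ : Fin n => Finset.Icc (-(⌊√R⌋₊ : ℤ)) ⌊√R⌋₊),
        ∏ i, ((1 : ℝ) + (k i : ℝ) ^ 2) ^ (-β) :=
        Finset.sum_le_sum fun k _ => pe_prod_bound hn h0 k
    _ = ∏ i : Fin n, ∑ j ∈ Finset.Icc (-(⌊√R⌋₊ : ℤ)) ⌊√R⌋₊, ((1 : ℝ) + (j : ℝ) ^ 2) ^ (-β) := by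
        rw [Finset.prod_univ_sum]
    _ ≤ ∏ i : Fin n, ((1 + 2 / (1 - 2 * β)) * R ^ (1 / 2 - β)) := by
        apply Finset.prod_le_prod
        · intro i _; exact Finset.sum_nonneg fun j _ => by positivity
        · intro i _
          refine (pe_oneD hb0 hb1 _).trans ?_
          have a1 : (1 : ℝ) ≤ R ^ (1 / 2 - β) := Real.one_le_rpow hR (by linarith)
          have a2 : ((⌊√R⌋₊ : ℕ) : ℝ) ^ (1 - 2 * β) ≤ R ^ (1 / 2 - β) := by
            have : R ^ (1 / 2 - β) = (√R) ^ (1 - 2 * β) := by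
              rw [Real.sqrt_eq_rpow, ← Real.rpow_mul hR0]; congr 1; ring
            rw [this]
            exact Real.rpow_le_rpow (Nat.cast_nonneg _) (Nat.floor_le (Real.sqrt_nonneg _)) hγ.le
          have a3 : 0 < 2 / (1 - 2 * β) := by positivity
          nlinarith
    _ = _ := by
        rw [Finset.prod_const, Finset.card_univ, Fintype.card_fin, mul_pow]
        congr 1
        rw [← Real.rpow_natCast, ← Real.rpow_mul hR0]
        congr 1
        rw [hβ]; field_simp

/-- `ENNReal`-valued weight. -/
def peE {n : ℕ} (s : ℝ) (k : Fin n → ℤ) : ENNReal := ENNReal.ofReal (peW k ^ s)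

lemma peE_add {n : ℕ} (s t : ℝ) (k : Fin n → ℤ) : peE s k * peE t k = peE (s + t) k := by
  unfold peE
  rw [← ENNReal.ofReal_mul (Real.rpow_nonneg (peW_pos k).le _), Real.rpow_add (peW_pos k)]

lemma pe_count {n : ℕ} (hn : 0 < n) {α : ℝ} (h1 : α < n / 2) :
    ∃ C : ENNReal, C ≠ ⊤ ∧ ∀ R : ℝ, 1 ≤ R →
      ∑' k : Fin n → ℤ, (if peW k ≤ R then peE (-α) k else 0)
        ≤ C * ENNReal.ofReal (R ^ (n / 2 - α)) := by
  have hn' : (0 : ℝ) < n := by positivity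
  obtain ⟨C, hC, h⟩ := pe_count0 hn (α := max α 0) (le_max_right _ _) (max_lt h1 (by positivity))
  refine ⟨ENNReal.ofReal C, ENNReal.ofReal_ne_top, fun R hR => ?_⟩
  have hR0 : 0 < R := by linarith
  rw [tsum_eq_sum (s := Fintype.piFinset
      (fun _ : Fin n => Finset.Icc (-(⌊√R⌋₊ : ℤ)) ⌊√R⌋₊))
    (fun k hk => if_neg fun hk' => hk (pe_mem_box k hk'))]
  calc _ ≤ ∑ k ∈ Fintype.piFinset (fun _ : Fin n => Finset.Icc (-(⌊√R⌋₊ : ℤ)) ⌊√R⌋₊),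
        ENNReal.ofReal (R ^ (max α 0 - α) * peW k ^ (-(max α 0))) := by
        apply Finset.sum_le_sum
        intro k _
        split_ifs with hk
        · unfold peE
          apply ENNReal.ofReal_le_ofReal
          have : peW k ^ (-α) = peW k ^ (max α 0 - α) * peW k ^ (-(max α 0)) := by
            rw [← Real.rpow_add (peW_pos k)]; congr 1; ring
          rw [this]
          have p := peW_pos k
          gcongr
          linarith [le_max_left α 0]
        · exact zero_le
    _ = ENNReal.ofReal (R ^ (max α 0 - α) * ∑ k ∈ Fintype.piFinset
          (fun _ : Fin n => Finset.Icc (-(⌊√R⌋₊ : ℤ)) ⌊√R⌋₊), peW k ^ (-(max α 0))) := by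
        rw [Finset.mul_sum, ENNReal.ofReal_sum_of_nonneg]
        intro k _
        have p := peW_pos k
        positivity
    _ ≤ _ := by
        rw [← ENNReal.ofReal_mul hC.le]
        apply ENNReal.ofReal_le_ofReal
        calc _ ≤ R ^ (max α 0 - α) * (C * R ^ (n / 2 - max α 0)) := by
              gcongr; exact h R hR
          _ = C * (R ^ (max α 0 - α) * R ^ (n / 2 - max α 0)) := by ring
          _ = _ := by rw [← Real.rpow_add hR0]; congr 2; ring

lemma pe_cs {ι : Type*} (a b : ι → ENNReal) :
    (∑' i, a i * b i) ^ 2 ≤ (∑' i, a i ^ 2) * ∑' i, b i ^ 2 := by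
  let _ : MeasurableSpace ι := ⊤
  have h := ENNReal.lintegral_mul_le_Lp_mul_Lq (Measure.count : Measure ι)
    (p := 2) (q := 2) ⟨by norm_num, by norm_num, by norm_num⟩
    (f := a) (g := b) (measurable_from_top.aemeasurable) (measurable_from_top.aemeasurable)
  simp only [lintegral_count, Pi.mul_apply] at h
  calc _ ≤ _ := pow_le_pow_left' h 2
    _ = _ := by
      rw [mul_pow, ← ENNReal.rpow_natCast, ← ENNReal.rpow_natCast, ← ENNReal.rpow_mul,
        ← ENNReal.rpow_mul]
      norm_num

lemma pe_enorm_tsum {ι : Type*} (a : ι → ℂ) : ‖∑' i, a i‖ₑ ≤ ∑' i, ‖a i‖ₑ := by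
  exact enorm_tsum_le_tsum_enorm

lemma peE_sq {n : ℕ} (s : ℝ) (k : Fin n → ℤ) : peE s k ^ 2 = peE (2 * s) k := by
  rw [sq, peE_add]; congr 1; ring

lemma peE_zero {n : ℕ} (k : Fin n → ℤ) : peE 0 k = 1 := by simp [peE]

lemma peE_comp {n : ℕ} (s : ℝ) (k l : Fin n → ℤ) (h1 : peW k ≤ 4 * peW l)
    (h2 : peW l ≤ 4 * peW k) : peE s k ≤ ENNReal.ofReal (4 ^ |s|) * peE s l := by
  unfold peE
  rw [← ENNReal.ofReal_mul (by positivity)]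
  apply ENNReal.ofReal_le_ofReal
  have pk := peW_pos k
  have pl := peW_pos l
  rcases le_total 0 s with hs | hs
  · rw [abs_of_nonneg hs, ← Real.mul_rpow (by norm_num) pl.le]
    exact Real.rpow_le_rpow pk.le h1 hs
  · have : peW l ^ s = (4 : ℝ) ^ s * (peW l / 4) ^ s := by
      rw [← Real.mul_rpow (by norm_num) (by positivity)]; congr 1; ring
    rw [abs_of_nonpos hs, this, ← mul_assoc, ← Real.rpow_add (by norm_num)]
    simp only [neg_add_cancel, Real.rpow_zero, one_mul]
    exact Real.rpow_le_rpow_of_nonpos (by positivity) (by linarith) hs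

lemma pe_conv {n : ℕ} (A B : (Fin n → ℤ) → ENNReal) :
    ∑' k, ∑' m, A m * B (k - m) = (∑' m, A m) * ∑' m, B m := by
  rw [ENNReal.tsum_comm, ← ENNReal.tsum_mul_right]
  refine tsum_congr fun m => ?_
  rw [ENNReal.tsum_mul_left]
  congr 1
  exact (Equiv.subRight m).tsum_eq B

/-- low-high part of the convolution -/
def peLow {n : ℕ} (P Q : (Fin n → ℤ) → ENNReal) (k : Fin n → ℤ) : ENNReal :=
  open Classical in
  ∑' m, if peW m ≤ peW k ∧ peW m ≤ peW (k - m) then P m * Q (k - m) else 0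

/-- high-high part of the convolution -/
def peHigh {n : ℕ} (P Q : (Fin n → ℤ) → ENNReal) (k : Fin n → ℤ) : ENNReal :=
  open Classical in
  ∑' m, if peW k ≤ peW m ∧ peW k ≤ peW (k - m) then P m * Q (k - m) else 0

lemma pe_tri1 {n : ℕ} (k m : Fin n → ℤ) : peW k ≤ 2 * (peW m + peW (k - m)) := by
  have := peW_add m (k - m)
  rwa [add_sub_cancel] at this

lemma pe_tri2 {n : ℕ} (k m : Fin n → ℤ) : peW (k - m) ≤ 2 * (peW k + peW m) := by
  have := peW_add k (-m)
  rwa [← sub_eq_add_neg, peW_neg] at this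

lemma pe_tri3 {n : ℕ} (k m : Fin n → ℤ) : peW m ≤ 2 * (peW k + peW (k - m)) := by
  have := peW_add k (-(k - m))
  rwa [← sub_eq_add_neg, peW_neg, sub_sub_cancel] at this

lemma pe_low {n : ℕ} (hn : 0 < n) (s₁ s₂ : ℝ) (h1 : s₁ < n / 2) :
    ∃ C : ENNReal, C ≠ ⊤ ∧ ∀ P Q : (Fin n → ℤ) → ENNReal,
      ∑' k, peE (s₁ + s₂ - n / 2) k * peLow P Q k ^ 2
        ≤ C * ((∑' k, peE s₁ k * P k ^ 2) * ∑' k, peE s₂ k * Q k ^ 2) := by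
  classical
  obtain ⟨C, hC, h⟩ := pe_count hn h1
  refine ⟨C * ENNReal.ofReal (4 ^ |s₂|), ENNReal.mul_ne_top hC ENNReal.ofReal_ne_top,
    fun P Q => ?_⟩
  rw [← pe_conv, ← ENNReal.tsum_mul_left]
  refine ENNReal.tsum_le_tsum fun k => ?_
  have cs : peLow P Q k ^ 2 ≤ (C * peE (n / 2 - s₁) k) *
      ∑' m, if peW m ≤ peW k ∧ peW m ≤ peW (k - m) then
        (peE s₁ m * P m ^ 2) * Q (k - m) ^ 2 else 0 := by
    calc peLow P Q k ^ 2 = (∑' m, (if peW m ≤ peW k then peE (-(s₁ / 2)) m else 0) *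
          (if peW m ≤ peW k ∧ peW m ≤ peW (k - m) then
            peE (s₁ / 2) m * P m * Q (k - m) else 0)) ^ 2 := by
          unfold peLow
          congr 1
          refine tsum_congr fun m => ?_
          by_cases hm : peW m ≤ peW k ∧ peW m ≤ peW (k - m)
          · rw [if_pos hm, if_pos hm, if_pos hm.1, ← mul_assoc, ← mul_assoc, peE_add,
              neg_add_cancel, peE_zero, one_mul]
          · rw [if_neg hm, if_neg hm, mul_zero]
      _ ≤ _ := pe_cs _ _
      _ ≤ _ := by
          gcongr with m
          · refine le_trans (le_of_eq ?_) (h (peW k) (peW_ge k))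
            refine tsum_congr fun m => ?_
            split_ifs
            · rw [peE_sq]; congr 1; ring
            · simp
          · split_ifs
            · rw [mul_pow, mul_pow, peE_sq]
              apply le_of_eq; congr 3; ring
            · simp
  calc _ ≤ peE (s₁ + s₂ - n / 2) k * ((C * peE (n / 2 - s₁) k) *
      ∑' m, if peW m ≤ peW k ∧ peW m ≤ peW (k - m) then
        (peE s₁ m * P m ^ 2) * Q (k - m) ^ 2 else 0) := by gcongr
    _ = C * (peE s₂ k * ∑' m, if peW m ≤ peW k ∧ peW m ≤ peW (k - m) then
        (peE s₁ m * P m ^ 2) * Q (k - m) ^ 2 else 0) := by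
        have : peE s₂ k = peE (s₁ + s₂ - n / 2) k * peE (n / 2 - s₁) k := by
          rw [peE_add]; congr 1; ring
        rw [this]; ring
    _ ≤ _ := by
        rw [mul_assoc C]
        refine mul_le_mul_right ?_ C
        rw [← ENNReal.tsum_mul_left, ← ENNReal.tsum_mul_left]
        refine ENNReal.tsum_le_tsum fun m => ?_
        split_ifs with hm
        · have t1 := pe_tri1 k m
          have t2 := pe_tri2 k m
          have := peE_comp s₂ k (k - m) (by linarith) (by linarith)
          calc _ ≤ (ENNReal.ofReal (4 ^ |s₂|) * peE s₂ (k - m)) *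
                ((peE s₁ m * P m ^ 2) * Q (k - m) ^ 2) := by gcongr
            _ = _ := by ring
        · simp

lemma pe_high {n : ℕ} (hn : 0 < n) (s₁ s₂ : ℝ) (h0 : 0 < s₁ + s₂) :
    ∃ C : ENNReal, C ≠ ⊤ ∧ ∀ P Q : (Fin n → ℤ) → ENNReal,
      ∑' k, peE (s₁ + s₂ - n / 2) k * peHigh P Q k ^ 2
        ≤ C * ((∑' k, peE s₁ k * P k ^ 2) * ∑' k, peE s₂ k * Q k ^ 2) := by
  classical
  obtain ⟨C, hC, h⟩ := pe_count (α := n / 2 - (s₁ + s₂)) hn (by linarith)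
  set b := (s₁ - s₂) / 2 with hb
  refine ⟨ENNReal.ofReal (4 ^ |(-b)|) * C, ENNReal.mul_ne_top ENNReal.ofReal_ne_top hC,
    fun P Q => ?_⟩
  have cs : ∀ k, peHigh P Q k ^ 2 ≤ ENNReal.ofReal (4 ^ |(-b)|) *
      ((∑' m, if peW k ≤ peW m then peE b m * P m ^ 2 else 0) *
        ∑' l, if peW k ≤ peW l then peE (-b) l * Q l ^ 2 else 0) := by
    intro k
    calc peHigh P Q k ^ 2 = (∑' m, (if peW k ≤ peW m then peE (b / 2) m * P m else 0) *
          (if peW k ≤ peW m ∧ peW k ≤ peW (k - m) then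
            peE (-(b / 2)) m * Q (k - m) else 0)) ^ 2 := by
          unfold peHigh
          congr 1
          refine tsum_congr fun m => ?_
          by_cases hm : peW k ≤ peW m ∧ peW k ≤ peW (k - m)
          · rw [if_pos hm, if_pos hm, if_pos hm.1]
            have : peE (b / 2) m * P m * (peE (-(b / 2)) m * Q (k - m)) =
              (peE (b / 2) m * peE (-(b / 2)) m) * (P m * Q (k - m)) := by ring
            rw [this, peE_add, add_neg_cancel, peE_zero, one_mul]
          · rw [if_neg hm, if_neg hm, mul_zero]
      _ ≤ _ := pe_cs _ _
      _ ≤ (∑' m, if peW k ≤ peW m then peE b m * P m ^ 2 else 0) *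
          (ENNReal.ofReal (4 ^ |(-b)|) *
            ∑' l, if peW k ≤ peW l then peE (-b) l * Q l ^ 2 else 0) := by
          gcongr with m
          · split_ifs
            · rw [mul_pow, peE_sq]
              apply le_of_eq; congr 2; ring
            · simp
          · rw [← (Equiv.subLeft k).tsum_eq
              (fun l => if peW k ≤ peW l then peE (-b) l * Q l ^ 2 else 0),
              ← ENNReal.tsum_mul_left]
            refine ENNReal.tsum_le_tsum fun m => ?_
            simp only [Equiv.subLeft_apply]
            by_cases hm : peW k ≤ peW m ∧ peW k ≤ peW (k - m)
            · rw [if_pos hm, if_pos hm.2, mul_pow, peE_sq, ← mul_assoc]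
              have t2 := pe_tri2 k m
              have t3 := pe_tri3 k m
              have := peE_comp (-b) m (k - m) (by linarith) (by linarith)
              have e : 2 * -(b / 2) = -b := by ring
              rw [e]
              gcongr
            · rw [if_neg hm]; simp
      _ = _ := by ring
  have key : ∀ m l : Fin n → ℤ,
      ∑' k : Fin n → ℤ, (if peW k ≤ peW m ∧ peW k ≤ peW l then peE (s₁ + s₂ - n / 2) k else 0)
        ≤ C * (peE ((s₁ + s₂) / 2) m * peE ((s₁ + s₂) / 2) l) := by
    intro m l
    have pm := peW_pos m
    have pl := peW_pos l
    have hR := h (min (peW m) (peW l)) (le_min (peW_ge m) (peW_ge l))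
    simp only [le_min_iff, neg_sub, sub_sub_cancel] at hR
    refine hR.trans ?_
    gcongr
    unfold peE
    rw [← ENNReal.ofReal_mul (by positivity)]
    apply ENNReal.ofReal_le_ofReal
    have hp : 0 < min (peW m) (peW l) := lt_min pm pl
    rw [← add_halves (s₁ + s₂), Real.rpow_add hp, add_halves]
    gcongr
    · exact min_le_left _ _
    · exact min_le_right _ _
  calc _ ≤ ∑' k, peE (s₁ + s₂ - n / 2) k * (ENNReal.ofReal (4 ^ |(-b)|) *
      ((∑' m, if peW k ≤ peW m then peE b m * P m ^ 2 else 0) *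
        ∑' l, if peW k ≤ peW l then peE (-b) l * Q l ^ 2 else 0)) := by
        gcongr with k; exact cs k
    _ = ENNReal.ofReal (4 ^ |(-b)|) * ∑' k, ∑' m, ∑' l,
        (if peW k ≤ peW m ∧ peW k ≤ peW l then peE (s₁ + s₂ - n / 2) k else 0) *
          ((peE b m * P m ^ 2) * (peE (-b) l * Q l ^ 2)) := by
        rw [← ENNReal.tsum_mul_left]
        refine tsum_congr fun k => ?_
        rw [mul_left_comm]
        congr 1
        rw [← ENNReal.tsum_mul_right, ← ENNReal.tsum_mul_left]
        refine tsum_congr fun m => ?_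
        rw [← ENNReal.tsum_mul_left, ← ENNReal.tsum_mul_left]
        refine tsum_congr fun l => ?_
        by_cases c1 : peW k ≤ peW m <;> by_cases c2 : peW k ≤ peW l <;> simp [c1, c2]
    _ = ENNReal.ofReal (4 ^ |(-b)|) * ∑' m, ∑' l,
        (∑' k : Fin n → ℤ, if peW k ≤ peW m ∧ peW k ≤ peW l then peE (s₁ + s₂ - n / 2) k else 0) *
          ((peE b m * P m ^ 2) * (peE (-b) l * Q l ^ 2)) := by
        rw [ENNReal.tsum_comm]
        congr 1
        refine tsum_congr fun m => ?_
        rw [ENNReal.tsum_comm]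
        refine tsum_congr fun l => ?_
        rw [ENNReal.tsum_mul_right]
    _ ≤ ENNReal.ofReal (4 ^ |(-b)|) * ∑' m, ∑' l,
        (C * (peE ((s₁ + s₂) / 2) m * peE ((s₁ + s₂) / 2) l)) *
          ((peE b m * P m ^ 2) * (peE (-b) l * Q l ^ 2)) := by
        gcongr with m l; exact key m l
    _ = _ := by
        rw [mul_assoc]
        congr 1
        rw [← ENNReal.tsum_mul_right, ← ENNReal.tsum_mul_left]
        refine tsum_congr fun m => ?_
        rw [← ENNReal.tsum_mul_left, ← ENNReal.tsum_mul_left]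
        refine tsum_congr fun l => ?_
        have e1 : peE s₁ m = peE ((s₁ + s₂) / 2) m * peE b m := by
          rw [peE_add]; congr 1; rw [hb]; ring
        have e2 : peE s₂ l = peE ((s₁ + s₂) / 2) l * peE (-b) l := by
          rw [peE_add]; congr 1; rw [hb]; ring
        rw [e1, e2]; ring

lemma pe_split {n : ℕ} (P Q : (Fin n → ℤ) → ENNReal) (k : Fin n → ℤ) :
    ∑' m, P m * Q (k - m) ≤ peLow P Q k + peLow Q P k + peHigh P Q k := by
  classical
  have e : peLow Q P k = ∑' m, if peW (k - m) ≤ peW k ∧ peW (k - m) ≤ peW m then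
      P m * Q (k - m) else 0 := by
    unfold peLow
    rw [← (Equiv.subLeft k).tsum_eq]
    refine tsum_congr fun m => ?_
    simp only [Equiv.subLeft_apply, sub_sub_cancel]
    rw [mul_comm]
  rw [e]
  unfold peLow peHigh
  rw [← ENNReal.tsum_add, ← ENNReal.tsum_add]
  refine ENNReal.tsum_le_tsum fun m => ?_
  have : (peW m ≤ peW k ∧ peW m ≤ peW (k - m)) ∨ (peW (k - m) ≤ peW k ∧ peW (k - m) ≤ peW m) ∨
      (peW k ≤ peW m ∧ peW k ≤ peW (k - m)) := by
    grind
  rcases this with c | c | c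
  · rw [if_pos c, add_assoc]; exact le_self_add
  · rw [if_pos c, add_right_comm]; exact le_add_self
  · rw [if_pos c]; exact le_add_self

lemma pe_sq3 (a b c : ENNReal) : (a + b + c) ^ 2 ≤ 4 * (a ^ 2 + b ^ 2 + c ^ 2) := by
  have h2 : ∀ x y : ENNReal, (x + y) ^ 2 ≤ 2 * (x ^ 2 + y ^ 2) := by
    intro x y
    have := ENNReal.rpow_add_le_mul_rpow_add_rpow x y (p := 2) (by norm_num)
    norm_num at this
    exact this
  calc _ ≤ 2 * ((a + b) ^ 2 + c ^ 2) := h2 _ _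
    _ ≤ 2 * (2 * (a ^ 2 + b ^ 2) + 2 * c ^ 2) := by
      gcongr
      · exact h2 a b
      · rw [two_mul]; exact le_self_add
    _ = _ := by ring

lemma pe_main {n : ℕ} (hn : 0 < n) (s₁ s₂ : ℝ) (h1 : s₁ < n / 2) (h2 : s₂ < n / 2)
    (h0 : 0 < s₁ + s₂) :
    ∃ C : ENNReal, C ≠ ⊤ ∧ ∀ f g : (Fin n → ℤ) → ℂ,
      ∑' k, peE (s₁ + s₂ - n / 2) k * ‖convF f g k‖ₑ ^ 2
        ≤ C * ((∑' k, peE s₁ k * ‖f k‖ₑ ^ 2) * ∑' k, peE s₂ k * ‖g k‖ₑ ^ 2) := by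
  obtain ⟨C1, hC1, H1⟩ := pe_low hn s₁ s₂ h1
  obtain ⟨C2, hC2, H2⟩ := pe_low hn s₂ s₁ h2
  obtain ⟨C3, hC3, H3⟩ := pe_high hn s₁ s₂ h0
  refine ⟨4 * (C1 + C2 + C3), by finiteness, fun f g => ?_⟩
  set P : (Fin n → ℤ) → ENNReal := fun k => ‖f k‖ₑ
  set Q : (Fin n → ℤ) → ENNReal := fun k => ‖g k‖ₑ
  have H2' := H2 Q P
  rw [add_comm s₂ s₁, mul_comm (∑' k, peE s₂ k * Q k ^ 2)] at H2'
  have hk : ∀ k, ‖convF f g k‖ₑ ≤ peLow P Q k + peLow Q P k + peHigh P Q k := by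
    intro k
    refine le_trans ?_ (pe_split P Q k)
    refine (pe_enorm_tsum _).trans (le_of_eq ?_)
    exact tsum_congr fun m => enorm_mul _ _
  calc _ ≤ ∑' k, peE (s₁ + s₂ - n / 2) k *
        (4 * (peLow P Q k ^ 2 + peLow Q P k ^ 2 + peHigh P Q k ^ 2)) := by
        gcongr with k
        exact (pow_le_pow_left' (hk k) 2).trans (pe_sq3 _ _ _)
    _ = 4 * (∑' k, peE (s₁ + s₂ - n / 2) k * peLow P Q k ^ 2 +
        ∑' k, peE (s₁ + s₂ - n / 2) k * peLow Q P k ^ 2 +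
        ∑' k, peE (s₁ + s₂ - n / 2) k * peHigh P Q k ^ 2) := by
        rw [← ENNReal.tsum_add, ← ENNReal.tsum_add, ← ENNReal.tsum_mul_left]
        refine tsum_congr fun k => ?_
        ring
    _ ≤ 4 * (C1 * ((∑' k, peE s₁ k * P k ^ 2) * ∑' k, peE s₂ k * Q k ^ 2) +
        C2 * ((∑' k, peE s₁ k * P k ^ 2) * ∑' k, peE s₂ k * Q k ^ 2) +
        C3 * ((∑' k, peE s₁ k * P k ^ 2) * ∑' k, peE s₂ k * Q k ^ 2)) := by
        gcongr
        · exact H1 P Q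
        · exact H3 P Q
    _ = _ := by ring

lemma pe_term {n : ℕ} (s : ℝ) (c : (Fin n → ℤ) → ℂ) (k : Fin n → ℤ) :
    peE s k * ‖c k‖ₑ ^ 2 = ENNReal.ofReal (((1 : ℝ) + freqNorm k ^ 2) ^ s * ‖c k‖ ^ 2) := by
  change _ = ENNReal.ofReal (peW k ^ s * ‖c k‖ ^ 2)
  rw [ENNReal.ofReal_mul (Real.rpow_nonneg (peW_pos k).le _), ENNReal.ofReal_pow (norm_nonneg _),
    ofReal_norm_eq_enorm]
  rfl

lemma pe_nonneg {n : ℕ} (s : ℝ) (c : (Fin n → ℤ) → ℂ) (k : Fin n → ℤ) :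
    0 ≤ ((1 : ℝ) + freqNorm k ^ 2) ^ s * ‖c k‖ ^ 2 := by
  positivity

lemma pe_tsum {n : ℕ} (s : ℝ) (c : (Fin n → ℤ) → ℂ) (h : memHs s c) :
    ∑' k, peE s k * ‖c k‖ₑ ^ 2 =
      ENNReal.ofReal (∑' k, ((1 : ℝ) + freqNorm k ^ 2) ^ s * ‖c k‖ ^ 2) := by
  rw [ENNReal.ofReal_tsum_of_nonneg (pe_nonneg s c) h]
  exact tsum_congr (pe_term s c)

/-- **Lemma 2.5.** Let `s₁, s₂ < 1/2` with `s₁ + s₂ > 0`.  If `f ∈ H^{s₁}(𝕋ⁿ)`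
and `g ∈ H^{s₂}(𝕋ⁿ)`, then `fg ∈ H^{s₁+s₂-n/2}` and
`‖fg‖_{H^{s₁+s₂-n/2}} ≤ C ‖f‖_{H^{s₁}} ‖g‖_{H^{s₂}}`
for a constant `C = C(n, s₁, s₂) > 0`. -/
theorem product_estimate (n : ℕ) (hn : 0 < n) (s₁ s₂ : ℝ)
    (hs₁ : s₁ < 1 / 2) (hs₂ : s₂ < 1 / 2) (hsum : 0 < s₁ + s₂) :
    ∃ C > (0 : ℝ), ∀ f g : (Fin n → ℤ) → ℂ,
      memHs s₁ f → memHs s₂ g →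
      memHs (s₁ + s₂ - n / 2) (convF f g) ∧
        hsNorm (s₁ + s₂ - n / 2) (convF f g) ≤ C * hsNorm s₁ f * hsNorm s₂ g := by
  have hn1 : (1 : ℝ) ≤ n := by exact_mod_cast hn
  obtain ⟨K, hK, H⟩ := pe_main hn s₁ s₂ (by linarith) (by linarith) hsum
  refine ⟨(K.toReal + 1) ^ (1 / 2 : ℝ), by positivity, fun f g hf hg => ?_⟩
  have h := H f g
  rw [pe_tsum s₁ f hf, pe_tsum s₂ g hg] at h
  have hmem : memHs (s₁ + s₂ - n / 2) (convF f g) := by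
    unfold memHs
    have hne : ∑' k, ENNReal.ofReal
        (((1 : ℝ) + freqNorm k ^ 2) ^ (s₁ + s₂ - n / 2) * ‖convF f g k‖ ^ 2) ≠ ⊤ := by
      rw [← tsum_congr (pe_term (s₁ + s₂ - n / 2) (convF f g))]
      exact ne_top_of_le_ne_top (by finiteness) h
    have := ENNReal.summable_toReal hne
    simpa only [ENNReal.toReal_ofReal (pe_nonneg _ _ _)] using this
  refine ⟨hmem, ?_⟩
  rw [pe_tsum _ _ hmem] at h
  have n1 : 0 ≤ ∑' k, ((1 : ℝ) + freqNorm k ^ 2) ^ s₁ * ‖f k‖ ^ 2 := tsum_nonneg (pe_nonneg _ _)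
  have n2 : 0 ≤ ∑' k, ((1 : ℝ) + freqNorm k ^ 2) ^ s₂ * ‖g k‖ ^ 2 := tsum_nonneg (pe_nonneg _ _)
  rw [← ENNReal.ofReal_toReal hK, ← ENNReal.ofReal_mul n1,
    ← ENNReal.ofReal_mul ENNReal.toReal_nonneg, ENNReal.ofReal_le_ofReal_iff (by positivity)] at h
  unfold hsNorm
  rw [← Real.mul_rpow (by positivity) n1, ← Real.mul_rpow (by positivity) n2]
  apply Real.rpow_le_rpow (tsum_nonneg (pe_nonneg _ _)) _ (by norm_num)
  refine h.trans ?_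
  rw [mul_assoc]
  gcongr
  linarith
end
end
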